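/- Let G be a finite group, let 𝒞 = (𝒳,𝒦) be a supercharacter theory of G, and let N be a normal subgroup of G that is 𝒞-normal. Then 𝒞_N = ({f(X) : X ∈ 𝒳}, {K ∈ 𝒦 : K ⊆ N}) is a G-invariant supercharacter theory of N, 𝒞^{G/N} = ({X ∈ 𝒳 : X ⊆ Irr(G/N)}, {KN/N : K ∈ 𝒦}) is a supercharacter theory of G/N, and moreover 𝒞_N * 𝒞^{G/N} = 𝒞 ∨ m(N,G), where ∨ is the join in the lattice of supercharacter theories of G and m(N,G) is the supercharacter theory of G whose superclasses are the conjugacy classes of G contained in N together with the preimages in G of the nontrivial conjugacy classes of G/N. -/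

import Mathlib

open scoped Classical

noncomputable section

/-- The set of irreducible complex characters of `G`. -/
def Irr (G : Type) [Group G] : Set (G → ℂ) :=
  {χ | ∃ V : FDRep ℂ G, CategoryTheory.Simple V ∧ FDRep.character V = χ}

/-- `σ_X = ∑_{ψ ∈ X} ψ(1)·ψ`. -/
def sigmaChar {G : Type} [Group G] (X : Set (G → ℂ)) : G → ℂ :=
  fun g => ∑ᶠ ψ ∈ X, ψ 1 * ψ g

/-- `P` is a set partition of the set `S`. -/
def IsPartitionOf {α : Type*} (S : Set α) (P : Set (Set α)) : Prop :=
  ∅ ∉ P ∧ (∀ p ∈ P, p ⊆ S) ∧ ∀ a ∈ S, ∃! p, p ∈ P ∧ a ∈ p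

/-- `(𝒳, 𝒦)` is a supercharacter theory of the finite group `G`. -/
def IsSCT (G : Type) [Group G] [Finite G]
    (𝒳 : Set (Set (G → ℂ))) (𝒦 : Set (Set G)) : Prop :=
  IsPartitionOf (Irr G) 𝒳 ∧ IsPartitionOf Set.univ 𝒦 ∧ 𝒳.ncard = 𝒦.ncard ∧
    ({1} : Set G) ∈ 𝒦 ∧
    ∀ X ∈ 𝒳, ∀ K ∈ 𝒦, ∀ g ∈ K, ∀ h ∈ K, sigmaChar X g = sigmaChar X h

/-- `K̂ = ∑_{g ∈ K} g ∈ ℂ[G]`. -/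
def ghat {G : Type} [Group G] (K : Set G) : MonoidAlgebra ℂ G :=
  ∑ᶠ g ∈ K, MonoidAlgebra.single g (1 : ℂ)

/-- The central idempotent `e_χ = (χ(1)/|G|) ∑_g conj(χ g)·g` attached to a character. -/
def eIdem (G : Type) [Group G] (χ : G → ℂ) : MonoidAlgebra ℂ G :=
  (χ 1 / (Nat.card G : ℂ)) •
    ∑ᶠ g : G, (starRingEnd ℂ) (χ g) • MonoidAlgebra.single g (1 : ℂ)

/-- `f_X = ∑_{ψ ∈ X} e_ψ`. -/
def fIdem (G : Type) [Group G] (X : Set (G → ℂ)) : MonoidAlgebra ℂ G :=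
  ∑ᶠ χ ∈ X, eIdem G χ

/-- Partition order: every part of `P` lies in some part of `Q`. -/
def PartLE {α : Type*} (P Q : Set (Set α)) : Prop := ∀ p ∈ P, ∃ q ∈ Q, p ⊆ q

/-- The join of two partitions of the same set: parts are connected components of
the relation "lying in a common part of `P` or of `Q`". -/
def PartJoin {α : Type*} (P Q : Set (Set α)) : Set (Set α) :=
  {C | ∃ a ∈ ⋃₀ P, C = {b | Relation.ReflTransGen
      (fun x y => (∃ p ∈ P, x ∈ p ∧ y ∈ p) ∨ ∃ q ∈ Q, x ∈ q ∧ y ∈ q) a b}}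

/-- Inner product of complex-valued functions on a finite group. -/
def cInner (H : Type) [Group H] (α β : H → ℂ) : ℂ :=
  (Nat.card H : ℂ)⁻¹ * ∑ᶠ h : H, α h * (starRingEnd ℂ) (β h)

/-- Restriction of a function on `G` to a subgroup. -/
def resChar {G : Type} [Group G] (H : Subgroup G) (χ : G → ℂ) : ↥H → ℂ := fun h => χ ↑h

/-- Extension by zero of a function on a subgroup. -/
def zeroExtend {G : Type} [Group G] (H : Subgroup G) (φ : ↥H → ℂ) : G → ℂ :=
  fun g => if h : g ∈ H then φ ⟨g, h⟩ else 0

/-- The induced class function `φ^G`. -/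
def indChar {G : Type} [Group G] (H : Subgroup G) (φ : ↥H → ℂ) : G → ℂ :=
  fun g => (Nat.card ↥H : ℂ)⁻¹ * ∑ᶠ x : G, zeroExtend H φ (x⁻¹ * g * x)

/-- The superclass of `x` with respect to a partition `𝒦` of `G`. -/
def sclass {G : Type} [Group G] (𝒦 : Set (Set G)) (x : G) : Set G := ⋃₀ {K ∈ 𝒦 | x ∈ K}

/-- Superinduction: `φ^{(G)}(x) = [G:H]·(1/|[x]|)·∑_{y ∈ [x]} φ⁰(y)`. -/
def superInd {G : Type} [Group G] (𝒦 : Set (Set G)) (H : Subgroup G) (φ : ↥H → ℂ) : G → ℂ :=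
  fun x => (H.index : ℂ) * (((sclass 𝒦 x).ncard : ℂ))⁻¹ * ∑ᶠ y ∈ sclass 𝒦 x, zeroExtend H φ y

/-- A subgroup is `𝒞`-normal when it is a union of superclasses. -/
def CNormal {G : Type} [Group G] (𝒦 : Set (Set G)) (N : Subgroup G) : Prop :=
  ∃ T ⊆ 𝒦, (N : Set G) = ⋃₀ T

/-- `Irr(G/N)` viewed inside `Irr(G)`: irreducible characters with `N` in their kernel. -/
def IrrOver {G : Type} [Group G] (N : Subgroup G) : Set (G → ℂ) :=
  {χ ∈ Irr G | ∀ n ∈ N, χ n = χ 1}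

/-- The set of irreducible constituents of the restriction of `θ` to `N`. -/
def constituentsOn {G : Type} [Group G] (N : Subgroup G) (θ : G → ℂ) : Set (↥N → ℂ) :=
  {ψ ∈ Irr ↥N | cInner ↥N (resChar N θ) ψ ≠ 0}

/-- `Irr(G|ψ)`: irreducible characters of `G` lying over `ψ ∈ Irr(N)`. -/
def irrOverChar {G : Type} [Group G] (N : Subgroup G) (ψ : ↥N → ℂ) : Set (G → ℂ) :=
  {χ ∈ Irr G | cInner ↥N (resChar N χ) ψ ≠ 0}

/-- `X^G = ⋃_{ψ ∈ X} Irr(G|ψ)` for `X ⊆ Irr(N)`. -/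
def indSet {G : Type} [Group G] (N : Subgroup G) (X : Set (↥N → ℂ)) : Set (G → ℂ) :=
  ⋃ ψ ∈ X, irrOverChar N ψ

/-- Conjugation of a normal subgroup by a group element. -/
def conjSub {G : Type} [Group G] {N : Subgroup G} (hN : N.Normal) (g : G) (n : ↥N) : ↥N :=
  ⟨g * ↑n * g⁻¹, hN.conj_mem ↑n n.2 g⟩

/-- The conjugation action of `g ∈ G` on class functions of a normal subgroup `N`. -/
def charConj {G : Type} [Group G] {N : Subgroup G} (hN : N.Normal) (g : G)
    (ψ : ↥N → ℂ) : ↥N → ℂ :=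
  fun n => ψ (conjSub hN g⁻¹ n)

/-- Inflation of a set of characters of `G/N` to characters of `G`. -/
def inflateSet {G : Type} [Group G] (N : Subgroup G) [N.Normal]
    (Y : Set (G ⧸ N → ℂ)) : Set (G → ℂ) :=
  (fun η => η ∘ (QuotientGroup.mk : G → G ⧸ N)) '' Y

/-- Deflation of a set of characters of `G` (with `N` in their kernels) to characters
of `G/N`. -/
def deflate {G : Type} [Group G] (N : Subgroup G) [N.Normal]
    (X : Set (G → ℂ)) : Set (G ⧸ N → ℂ) :=
  (fun χ => fun q : G ⧸ N => χ (Quotient.out q)) '' X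

/-- The natural map `M → MN/N ≤ G/N`. -/
def projMN {G : Type} [Group G] (M N : Subgroup G) [N.Normal] (m : ↥M) :
    ↥(M.map (QuotientGroup.mk' N)) :=
  ⟨QuotientGroup.mk' N ↑m, Subgroup.mem_map_of_mem _ m.2⟩

end

/-- The superclasses of the supercharacter theory `m(N,G) = Conj_G(N) * m(G/N)`:
conjugacy classes of `G` lying in `N` together with preimages in `G` of the nontrivial
conjugacy classes of `G/N`. -/
def mClasses {G : Type} [Group G] (N : Subgroup G) [N.Normal] : Set (Set G) :=
  {C | ∃ g ∈ N, C = {h | IsConj g h}} ∪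
    {C | ∃ q : G ⧸ N, q ≠ 1 ∧
      C = (QuotientGroup.mk : G → G ⧸ N) ⁻¹' {p | IsConj q p}}

noncomputable section

open CategoryTheory
open scoped ComplexOrder

/-- `θ` is constant on conjugacy classes. -/
def IsClassFun {G : Type} [Group G] (θ : G → ℂ) : Prop := ∀ g h, θ (h * g * h⁻¹) = θ g

theorem cInner_eq_sum {H : Type} [Group H] [Fintype H] (α β : H → ℂ) :
    cInner H α β = (Nat.card H : ℂ)⁻¹ * ∑ h : H, α h * (starRingEnd ℂ) (β h) := by
  rw [cInner, finsum_eq_sum_of_fintype]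

theorem card_ne_zero_complex (H : Type) [Group H] [Finite H] : (Nat.card H : ℂ) ≠ 0 :=
  Nat.cast_ne_zero.2 Nat.card_pos.ne'

/-- `cInner` as a linear functional of its first argument. -/
def cInnerLin (H : Type) [Group H] [Finite H] (β : H → ℂ) : (H → ℂ) →ₗ[ℂ] ℂ where
  toFun α := cInner H α β
  map_add' a b := by
    have := Fintype.ofFinite H
    simp [cInner_eq_sum, add_mul, Finset.sum_add_distrib, mul_add]
  map_smul' c a := by
    have := Fintype.ofFinite H
    simp [cInner_eq_sum, mul_assoc, ← Finset.mul_sum, mul_left_comm]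

theorem cInnerLin_apply {H : Type} [Group H] [Finite H] (α β : H → ℂ) :
    cInnerLin H β α = cInner H α β := rfl

theorem cInner_conj {H : Type} [Group H] [Finite H] (α β : H → ℂ) :
    (starRingEnd ℂ) (cInner H α β) = cInner H β α := by
  have := Fintype.ofFinite H
  simp [cInner_eq_sum, mul_comm]

/-- An invariant positive definite form makes `ρ g` and `(ρ g⁻¹)ᴴ` similar. -/
theorem trace_conj_eq_trace_inv {G n : Type} [Group G] [Fintype G] [Fintype n] [DecidableEq n]
    (ρ : G →* Matrix n n ℂ) (g : G) :
    (starRingEnd ℂ) (ρ g).trace = (ρ g⁻¹).trace := by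
  set S : Matrix n n ℂ := ∑ h : G, (ρ h).conjTranspose * ρ h with hS
  have hpos : S.PosDef := by
    rw [hS, ← Finset.add_sum_erase _ _ (Finset.mem_univ (1 : G))]
    refine Matrix.PosDef.add_posSemidef ?_ ?_
    · simpa using Matrix.PosDef.one
    · exact Matrix.posSemidef_sum _ fun h _ => Matrix.posSemidef_conjTranspose_mul_self _
  have hinv : (ρ g).conjTranspose * S * ρ g = S := by
    rw [hS, Finset.mul_sum, Finset.sum_mul]
    refine Fintype.sum_equiv (Equiv.mulRight g) _ _ fun h => ?_
    simp [Matrix.mul_assoc]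
  have hcomm : S * ρ g⁻¹ = (ρ g).conjTranspose * S := by
    conv_lhs => rw [← hinv]
    rw [Matrix.mul_assoc, ← map_mul, mul_inv_cancel, map_one, Matrix.mul_one]
  have hu : IsUnit S := hpos.isUnit
  have hdet : IsUnit S.det := (Matrix.isUnit_iff_isUnit_det S).1 hu
  have h1 : ρ g⁻¹ = S⁻¹ * ((ρ g).conjTranspose * S) := by
    rw [← hcomm, ← Matrix.mul_assoc, Matrix.nonsing_inv_mul S hdet, Matrix.one_mul]
  rw [h1, Matrix.trace_mul_comm, Matrix.mul_assoc, Matrix.mul_nonsing_inv S hdet, Matrix.mul_one,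
    Matrix.trace_conjTranspose]
  rfl

theorem FDRep.conj_character {G : Type} [Group G] [Finite G] (V : FDRep ℂ G) (g : G) :
    (starRingEnd ℂ) (V.character g) = V.character g⁻¹ := by
  have := Fintype.ofFinite G
  let b := Module.finBasis ℂ V
  let ρ : G →* Matrix _ _ ℂ := (MonoidHomClass.toMonoidHom (LinearMap.toMatrixAlgEquiv b)).comp V.ρ
  have h : ∀ x, V.character x = (ρ x).trace := fun x => by
    simp only [FDRep.character, ρ]
    rw [LinearMap.trace_eq_matrix_trace ℂ b]
    rfl
  rw [h, h, trace_conj_eq_trace_inv]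

theorem cInner_character {G : Type} [Group G] [Finite G] (V W : FDRep ℂ G) :
    cInner G V.character W.character = (Module.finrank ℂ (W ⟶ V) : ℂ) := by
  have := Fintype.ofFinite G
  have := invertibleOfNonzero (card_ne_zero_complex G)
  rw [← FDRep.scalar_product_char_eq_finrank_equivariant, cInner_eq_sum]
  simp_rw [FDRep.conj_character]

section Irr

variable {G : Type} [Group G]

theorem Irr.isClassFun {χ : G → ℂ} (hχ : χ ∈ Irr G) : IsClassFun χ := by
  obtain ⟨V, -, rfl⟩ := hχ
  exact fun g h => V.char_conj g h

theorem FDRep.trace_scalar [Fintype G] (V : FDRep ℂ G) {θ : G → ℂ} {c : ℂ}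
    (h : ∑ g : G, θ g • V.ρ g = c • (1 : V →ₗ[ℂ] V)) (x : G) :
    ∑ g : G, θ g * V.character (g * x) = c * V.character x := by
  have := congrArg (fun f => LinearMap.trace ℂ V (f * V.ρ x)) h
  simpa [Finset.sum_mul, FDRep.character] using this

theorem IsClassFun.sum_smul {ι : Type*} {s : Finset ι} {c : ι → ℂ} {f : ι → G → ℂ}
    (hf : ∀ i ∈ s, IsClassFun (f i)) : IsClassFun (∑ i ∈ s, c i • f i) := fun g h => by
  simp only [Finset.sum_apply, Pi.smul_apply]
  exact Finset.sum_congr rfl fun i hi => by rw [hf i hi g h]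

theorem IsClassFun.sub {α β : G → ℂ} (hα : IsClassFun α) (hβ : IsClassFun β) :
    IsClassFun (α - β) := fun g h => by simp [hα g h, hβ g h]

variable [Finite G]

theorem Irr.cInner_eq {χ ψ : G → ℂ} (hχ : χ ∈ Irr G) (hψ : ψ ∈ Irr G) :
    cInner G χ ψ = if χ = ψ then 1 else 0 := by
  obtain ⟨V, hV, rfl⟩ := hχ
  obtain ⟨W, hW, rfl⟩ := hψ
  rw [cInner_character, FDRep.finrank_hom_simple_simple]
  by_cases h : Nonempty (W ≅ V)
  · simp [h, FDRep.char_iso h.some]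
  · rw [if_neg h, if_neg]
    · simp
    · intro he
      have h1 := cInner_character V V
      have h2 := cInner_character V W
      rw [← he, h1, FDRep.finrank_hom_simple_simple, FDRep.finrank_hom_simple_simple, if_neg h,
        if_pos ⟨Iso.refl V⟩] at h2
      simp at h2

theorem Irr.cInner_self {χ : G → ℂ} (hχ : χ ∈ Irr G) : cInner G χ χ = 1 := by
  rw [Irr.cInner_eq hχ hχ, if_pos rfl]

theorem Irr.exists_degree {χ : G → ℂ} (hχ : χ ∈ Irr G) : ∃ n : ℕ, 0 < n ∧ χ 1 = n := by
  have h1 := Irr.cInner_self hχ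
  obtain ⟨V, hV, rfl⟩ := hχ
  refine ⟨_, ?_, V.char_one⟩
  by_contra h0
  have hz : Module.finrank ℂ V = 0 := by omega
  have : Subsingleton V := Module.finrank_zero_iff.1 hz
  have hc : V.character = 0 := by
    ext g
    simp [FDRep.character, Subsingleton.elim (V.ρ g) 0]
  rw [hc, ← cInnerLin_apply, map_zero] at h1
  exact zero_ne_one h1

theorem Irr.one_ne_zero {χ : G → ℂ} (hχ : χ ∈ Irr G) : χ 1 ≠ 0 := by
  obtain ⟨n, hn, h⟩ := Irr.exists_degree hχ
  rw [h]
  exact_mod_cast hn.ne'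

variable (G) in
theorem Irr.linearIndependent : LinearIndependent ℂ (Subtype.val : Irr G → (G → ℂ)) := by
  rw [linearIndependent_iff']
  intro s c hc i hi
  have := congrArg (cInnerLin G i.1) hc
  rw [map_sum, map_zero, Finset.sum_eq_single i] at this
  · simpa [cInnerLin_apply, Irr.cInner_self i.2] using this
  · intro j _ hj
    rw [map_smul, cInnerLin_apply, Irr.cInner_eq j.2 i.2, if_neg (fun h => hj (Subtype.ext h)),
      smul_zero]
  · exact fun h => absurd hi h

variable (G) in
theorem Irr.finite : (Irr G).Finite :=
  Set.finite_coe_iff.1 (Irr.linearIndependent G).finite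

/-- Schur's lemma for the central element attached to a class function. -/
theorem FDRep.sum_smul_eq_smul_id [Fintype G] (V : FDRep ℂ G) [Simple V] {θ : G → ℂ}
    (hθ : IsClassFun θ) : ∃ c : ℂ, ∑ g : G, θ g • V.ρ g = c • (1 : V →ₗ[ℂ] V) := by
  have h1 : Module.finrank ℂ (Representation.linHom V.ρ V.ρ).invariants = 1 := by
    rw [LinearEquiv.finrank_eq (Representation.linHom.invariantsEquivFDRepHom V V),
      finrank_endomorphism_simple_eq_one ℂ V]
  have hz : ∑ g : G, θ g • V.ρ g ∈ (Representation.linHom V.ρ V.ρ).invariants := by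
    rw [Representation.mem_invariants]
    intro x
    rw [Representation.linHom_apply]
    change V.ρ x * (_ * V.ρ x⁻¹) = _
    rw [Finset.sum_mul, Finset.mul_sum]
    refine Fintype.sum_equiv (MulAut.conj x).toEquiv _ _ fun g => ?_
    have := hθ g x
    simp_all [mul_assoc]
  have hi : (1 : V →ₗ[ℂ] V) ∈ (Representation.linHom V.ρ V.ρ).invariants := by
    rw [Representation.mem_invariants]
    intro x
    rw [Representation.linHom_apply]
    change V.ρ x * (1 * V.ρ x⁻¹) = _
    rw [one_mul, ← map_mul, mul_inv_cancel, map_one]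
  have hne : (⟨1, hi⟩ : (Representation.linHom V.ρ V.ρ).invariants) ≠ 0 := by
    intro h
    have h0 : (1 : V →ₗ[ℂ] V) = 0 := congrArg Subtype.val h
    refine Irr.one_ne_zero (χ := V.character) ⟨V, inferInstance, rfl⟩ ?_
    simp [FDRep.character, -FDRep.char_one, h0]
  obtain ⟨c, hc⟩ := (finrank_eq_one_iff_of_nonzero' _ hne).1 h1 ⟨_, hz⟩
  exact ⟨c, (congrArg Subtype.val hc).symm⟩

theorem Irr.convolution [Fintype G] {χ : G → ℂ} (hχ : χ ∈ Irr G) {θ : G → ℂ}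
    (hθ : IsClassFun θ) (x : G) :
    ∑ g : G, θ g * χ (g * x) = (∑ g : G, θ g * χ g) / χ 1 * χ x := by
  have h1 := Irr.one_ne_zero hχ
  obtain ⟨V, hV, rfl⟩ := hχ
  obtain ⟨c, hc⟩ := V.sum_smul_eq_smul_id hθ
  have h2 := V.trace_scalar hc 1
  simp only [mul_one] at h2
  rw [V.trace_scalar hc, h2, mul_div_cancel_right₀ _ h1]

theorem IsClassFun.smul_eq_zero_of_isSimpleModule [Fintype G] {θ : G → ℂ} (hθ : IsClassFun θ)
    (h : ∀ χ ∈ Irr G, ∑ g : G, θ g * χ g = 0)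
    (M : Type) [AddCommGroup M] [Module (MonoidAlgebra ℂ G) M]
    [IsSimpleModule (MonoidAlgebra ℂ G) M] (m : M) :
    (∑ g : G, MonoidAlgebra.single g (θ g) : MonoidAlgebra ℂ G) • m = 0 := by
  have := invertibleOfNonzero (card_ne_zero_complex G)
  let : Module ℂ M := Module.compHom M (algebraMap ℂ (MonoidAlgebra ℂ G))
  have : IsScalarTower ℂ (MonoidAlgebra ℂ G) M := .of_algebraMap_smul fun _ _ => rfl
  let ρ : Representation ℂ G M := Representation.ofModule' M
  have hρ : ∀ r (x : M), ρ.asAlgebraHom r x = r • x := fun r x => by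
    change (MonoidAlgebra.lift ℂ (M →ₗ[ℂ] M) G ((MonoidAlgebra.lift ℂ _ G).symm _)) r x = _
    rw [Equiv.apply_symm_apply]
    rfl
  let e : ρ.asModule ≃ₗ[MonoidAlgebra ℂ G] M :=
    { ρ.asModuleEquiv with
      map_smul' := fun r x => by
        change ρ.asModuleEquiv (r • x) = r • ρ.asModuleEquiv x
        rw [Representation.asModuleEquiv_map_smul, hρ] }
  have hirr : ρ.IsIrreducible :=
    (Representation.irreducible_iff_isSimpleModule_asModule ρ).2 (IsSimpleModule.congr e)
  have hfin : FiniteDimensional ℂ M := Module.Finite.trans (MonoidAlgebra ℂ G) _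
  let V : FDRep ℂ G := FDRep.of ρ
  have hV : Simple V := by
    rw [FDRep.simple_iff_char_is_norm_one]
    have := Representation.char_orthonormal ρ ρ
    rw [if_pos ⟨Representation.Equiv.refl ρ⟩] at this
    exact ((inv_mul_eq_one₀ (card_ne_zero_complex G)).1 this).symm
  have hmem : V.character ∈ Irr G := ⟨V, hV, rfl⟩
  obtain ⟨c, hc⟩ := V.sum_smul_eq_smul_id hθ
  have h0 := V.trace_scalar hc 1
  simp only [mul_one] at h0
  rw [h _ hmem, eq_comm, mul_eq_zero, or_iff_left (Irr.one_ne_zero hmem)] at h0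
  rw [h0, zero_smul] at hc
  have hact : ρ.asAlgebraHom (∑ g : G, MonoidAlgebra.single g (θ g)) = 0 := by
    simp only [map_sum, Representation.asAlgebraHom_single]
    exact hc
  rw [← hρ, hact, LinearMap.zero_apply]

theorem IsClassFun.eq_zero_of_sum_mul_eq_zero [Fintype G] {θ : G → ℂ} (hθ : IsClassFun θ)
    (h : ∀ χ ∈ Irr G, ∑ g : G, θ g * χ g = 0) : θ = 0 := by
  have hcard : NeZero (Nat.card G : ℂ) := ⟨card_ne_zero_complex G⟩
  have hz : (∑ g : G, MonoidAlgebra.single g (θ g) : MonoidAlgebra ℂ G) = 0 := by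
    rw [← Submodule.mem_bot (MonoidAlgebra ℂ G), ← IsSemisimpleRing.jacobson_eq_bot,
      Ring.jacobson, Module.jacobson, Submodule.mem_sInf]
    intro I hI
    have hs : IsSimpleModule (MonoidAlgebra ℂ G) (MonoidAlgebra ℂ G ⧸ I) :=
      isSimpleModule_iff_isCoatom.2 hI
    have h1 := hθ.smul_eq_zero_of_isSimpleModule h (MonoidAlgebra ℂ G ⧸ I)
      (Submodule.Quotient.mk 1)
    rwa [← Submodule.Quotient.mk_smul, smul_eq_mul, mul_one, Submodule.Quotient.mk_eq_zero] at h1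
  ext g
  have h2 := congrArg (fun w => MonoidAlgebra.coeff w g) hz
  simpa [Finsupp.single_apply, Finsupp.finsetSum_apply] using h2

theorem IsClassFun.eq_zero_of_cInner {θ : G → ℂ} (hθ : IsClassFun θ)
    (h : ∀ χ ∈ Irr G, cInner G θ χ = 0) : θ = 0 := by
  have := Fintype.ofFinite G
  have h1 : (fun g => (starRingEnd ℂ) (θ g)) = (0 : G → ℂ) := by
    refine IsClassFun.eq_zero_of_sum_mul_eq_zero (fun g x => by rw [hθ g x]) fun χ hχ => ?_
    have h2 := congrArg (starRingEnd ℂ) (h χ hχ)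
    rw [cInner_eq_sum] at h2
    simpa [card_ne_zero_complex G] using h2
  ext g
  simpa using congrFun h1 g

variable (G) in
/-- The irreducible characters as a finset. -/
def irrFin : Finset (G → ℂ) := (Irr.finite G).toFinset

theorem mem_irrFin {χ : G → ℂ} : χ ∈ irrFin G ↔ χ ∈ Irr G := Set.Finite.mem_toFinset _

theorem Irr.cInner_sum_smul {c : (G → ℂ) → ℂ} {s : Finset (G → ℂ)} (hs : ∀ χ ∈ s, χ ∈ Irr G)
    {ψ : G → ℂ} (hψ : ψ ∈ Irr G) :
    cInner G (∑ χ ∈ s, c χ • χ) ψ = if ψ ∈ s then c ψ else 0 := by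
  rw [← cInnerLin_apply, map_sum, ← Finset.sum_ite_eq' s ψ c]
  refine Finset.sum_congr rfl fun χ hχ => ?_
  rw [map_smul, cInnerLin_apply, Irr.cInner_eq (hs χ hχ) hψ]
  simp

theorem IsClassFun.eq_sum {θ : G → ℂ} (hθ : IsClassFun θ) :
    θ = ∑ χ ∈ irrFin G, cInner G θ χ • χ := by
  rw [← sub_eq_zero]
  refine IsClassFun.eq_zero_of_cInner
    (hθ.sub (IsClassFun.sum_smul fun χ hχ => Irr.isClassFun (mem_irrFin.1 hχ))) fun χ hχ => ?_
  rw [← cInnerLin_apply, map_sub, cInnerLin_apply, cInnerLin_apply,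
    Irr.cInner_sum_smul (fun χ hχ => mem_irrFin.1 hχ) hχ, if_pos (mem_irrFin.2 hχ), sub_self]

theorem IsClassFun.ext_cInner {α β : G → ℂ} (hα : IsClassFun α) (hβ : IsClassFun β)
    (h : ∀ χ ∈ Irr G, cInner G α χ = cInner G β χ) : α = β := by
  rw [← sub_eq_zero]
  refine (hα.sub hβ).eq_zero_of_cInner fun χ hχ => ?_
  rw [← cInnerLin_apply, map_sub, cInnerLin_apply, cInnerLin_apply, h χ hχ, sub_self]

theorem IsClassFun.parseval {α β : G → ℂ} (hα : IsClassFun α) :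
    cInner G α β = ∑ χ ∈ irrFin G, cInner G α χ * (starRingEnd ℂ) (cInner G β χ) := by
  conv_lhs => rw [hα.eq_sum, ← cInnerLin_apply, map_sum]
  simp only [map_smul, cInnerLin_apply, cInner_conj, smul_eq_mul]

theorem IsClassFun.exists_cInner_ne_zero {θ : G → ℂ} (hθ : IsClassFun θ) (h : θ ≠ 0) :
    ∃ χ ∈ Irr G, cInner G θ χ ≠ 0 := by
  by_contra! hc
  exact h (hθ.eq_zero_of_cInner hc)

theorem Irr.exists_cInner_res_eq_nat {χ : G → ℂ} (hχ : χ ∈ Irr G) (N : Subgroup G)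
    {ψ : N → ℂ} (hψ : ψ ∈ Irr N) : ∃ n : ℕ, cInner N (resChar N χ) ψ = n := by
  obtain ⟨V, -, rfl⟩ := hχ
  obtain ⟨W, -, rfl⟩ := hψ
  exact ⟨_, cInner_character (FDRep.of (V.ρ.comp N.subtype)) W⟩

variable (G) in
theorem one_mem_Irr : (1 : G → ℂ) ∈ Irr G := by
  have := Fintype.ofFinite G
  let V : FDRep ℂ G := FDRep.of (1 : G →* (ℂ →ₗ[ℂ] ℂ))
  have hc : V.character = 1 := by
    ext g
    change LinearMap.trace ℂ ℂ (1 : ℂ →ₗ[ℂ] ℂ) = 1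
    simp
  refine ⟨V, ?_, hc⟩
  rw [FDRep.simple_iff_char_is_norm_one, hc]
  simp

section Quotient

variable (N : Subgroup G)

theorem sum_comp_mk [Fintype G] [Fintype (G ⧸ N)] (f : G ⧸ N → ℂ) :
    ∑ g : G, f g = Nat.card N * ∑ q, f q := by
  have := Fintype.ofFinite N
  rw [Fintype.sum_equiv Subgroup.groupEquivQuotientProdSubgroup (fun g : G => f g)
    (fun p : (G ⧸ N) × N => f p.1) fun g => rfl, Fintype.sum_prod_type]
  simp [Finset.mul_sum]

variable [N.Normal]

theorem simple_inflate_iff (V : FDRep ℂ (G ⧸ N)) (W : FDRep ℂ G)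
    (h : W.character = fun g : G => V.character g) : Simple W ↔ Simple V := by
  have := Fintype.ofFinite G
  have := Fintype.ofFinite (G ⧸ N)
  rw [FDRep.simple_iff_char_is_norm_one, FDRep.simple_iff_char_is_norm_one, h,
    N.card_eq_card_quotient_mul_card_subgroup]
  have hs := sum_comp_mk N fun q => V.character q * V.character q⁻¹
  simp only [QuotientGroup.mk_inv]
  rw [hs, Nat.cast_mul, mul_comm, mul_left_inj' (card_ne_zero_complex N)]

theorem Irr.inflate_mem {η : G ⧸ N → ℂ} (hη : η ∈ Irr (G ⧸ N)) :
    (fun g : G => η g) ∈ IrrOver N := by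
  obtain ⟨V, hV, rfl⟩ := hη
  let W : FDRep ℂ G := FDRep.of (V.ρ.comp (QuotientGroup.mk' N))
  have hW : W.character = fun g : G => V.character g := rfl
  refine ⟨⟨W, ?_, hW⟩, fun n hn => ?_⟩
  · exact (simple_inflate_iff N V W hW).2 hV
  · simp only [(QuotientGroup.eq_one_iff n).2 hn, QuotientGroup.mk_one]

theorem IrrOver.exists_inflate {χ : G → ℂ} (hχ : χ ∈ IrrOver N) :
    ∃ η ∈ Irr (G ⧸ N), χ = fun g : G => η g := by
  have := Fintype.ofFinite N
  have := invertibleOfNonzero (card_ne_zero_complex N)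
  obtain ⟨⟨V, hV, rfl⟩, hχ⟩ := hχ
  have htriv : ∀ n ∈ N, V.ρ n = 1 := by
    have h1 := FDRep.average_char_eq_finrank_invariants
      (FDRep.of (V.ρ.comp N.subtype) : FDRep ℂ N)
    have h2 : ∀ n : N, (FDRep.of (V.ρ.comp N.subtype) : FDRep ℂ N).character n
        = Module.finrank ℂ V := fun n => (hχ n n.2).trans V.char_one
    simp only [h2, Finset.sum_const, Finset.card_univ, nsmul_eq_mul, Fintype.card_eq_nat_card] at h1
    rw [inv_mul_cancel_left₀ (card_ne_zero_complex N), Nat.cast_inj] at h1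
    have h3 := Submodule.eq_top_of_finrank_eq h1.symm
    intro n hn
    ext v
    have h4 : v ∈ Representation.invariants (FDRep.of (V.ρ.comp N.subtype) : FDRep ℂ N).ρ := by
      rw [h3]; trivial
    exact h4 ⟨n, hn⟩
  let W : FDRep ℂ (G ⧸ N) := FDRep.of (QuotientGroup.lift N V.ρ htriv)
  have hW : V.character = fun g : G => W.character g := rfl
  exact ⟨W.character, ⟨W, (simple_inflate_iff N W V hW).1 hV, rfl⟩, hW⟩

end Quotient

end Irr
end

noncomputable section

open scoped ComplexOrder

section Sigma

variable {G : Type} [Group G] [Finite G]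

theorem sigmaChar_eq_sum {X : Set (G → ℂ)} (hX : X ⊆ Irr G) :
    sigmaChar X = ∑ χ ∈ irrFin G with χ ∈ X, χ 1 • χ := by
  ext g
  rw [sigmaChar, finsum_mem_eq_sum_of_inter_support_eq (t := {χ ∈ irrFin G | χ ∈ X})]
  · simp
  · congr 1
    ext χ
    simp only [Finset.coe_filter, Set.mem_ofPred_eq, mem_irrFin]
    exact ⟨fun h => ⟨hX h, h⟩, fun h => h.2⟩

theorem cInner_sigmaChar {X : Set (G → ℂ)} (hX : X ⊆ Irr G) {χ : G → ℂ} (hχ : χ ∈ Irr G) :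
    cInner G (sigmaChar X) χ = if χ ∈ X then χ 1 else 0 := by
  rw [sigmaChar_eq_sum hX,
    Irr.cInner_sum_smul (fun χ h => mem_irrFin.1 (Finset.mem_filter.1 h).1) hχ]
  simp [mem_irrFin, hχ]

theorem sigmaChar_isClassFun {X : Set (G → ℂ)} (hX : X ⊆ Irr G) : IsClassFun (sigmaChar X) := by
  rw [sigmaChar_eq_sum hX]
  exact IsClassFun.sum_smul fun χ h => Irr.isClassFun (mem_irrFin.1 (Finset.mem_filter.1 h).1)

end Sigma

section Partition

theorem IsPartitionOf.eq_of_mem {α : Type*} {S : Set α} {P : Set (Set α)} (hP : IsPartitionOf S P)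
    {p q : Set α} (hp : p ∈ P) (hq : q ∈ P) {a : α} (hap : a ∈ p) (haq : a ∈ q) : p = q :=
  (hP.2.2 a (hP.2.1 p hp hap)).unique ⟨hp, hap⟩ ⟨hq, haq⟩

theorem IsPartitionOf.nonempty {α : Type*} {S : Set α} {P : Set (Set α)} (hP : IsPartitionOf S P)
    {p : Set α} (hp : p ∈ P) : p.Nonempty :=
  Set.nonempty_iff_ne_empty.2 fun h => hP.1 (h ▸ hp)

theorem IsPartitionOf.exists_mem {α : Type*} {S : Set α} {P : Set (Set α)}
    (hP : IsPartitionOf S P) {a : α} (ha : a ∈ S) : ∃ p ∈ P, a ∈ p :=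
  (hP.2.2 a ha).exists

theorem IsPartitionOf.of_eq_of_mem {α : Type*} {S : Set α} {P : Set (Set α)}
    (hne : ∀ p ∈ P, p.Nonempty) (hsub : ∀ p ∈ P, p ⊆ S) (hcov : ∀ a ∈ S, ∃ p ∈ P, a ∈ p)
    (heq : ∀ p ∈ P, ∀ q ∈ P, ∀ a ∈ p, a ∈ q → p = q) : IsPartitionOf S P := by
  refine ⟨fun h => Set.not_nonempty_empty (hne _ h), hsub, fun a ha => ?_⟩
  obtain ⟨p, hp, hap⟩ := hcov a ha
  exact ⟨p, ⟨hp, hap⟩, fun q hq => heq q hq.1 p hp a hq.2 hap⟩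

theorem IsPartitionOf.finite {α : Type*} {S : Set α} {P : Set (Set α)} (hP : IsPartitionOf S P)
    (hS : S.Finite) : P.Finite :=
  hS.finite_subsets.subset fun p hp => hP.2.1 p hp

/-- The functions which are constant on each member of `𝒦`. -/
def constFun {G : Type} (𝒦 : Set (Set G)) : Submodule ℂ (G → ℂ) where
  carrier := {θ | ∀ K ∈ 𝒦, ∀ g ∈ K, ∀ h ∈ K, θ g = θ h}
  add_mem' ha hb K hK g hg h hh := congrArg₂ (· + ·) (ha K hK g hg h hh) (hb K hK g hg h hh)
  zero_mem' _ _ _ _ _ _ := rfl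
  smul_mem' c _ ha K hK g hg h hh := congrArg (c * ·) (ha K hK g hg h hh)

theorem IsPartitionOf.indicator_mem_constFun {G : Type} {𝒦 : Set (Set G)}
    (h𝒦 : IsPartitionOf Set.univ 𝒦) {K : Set G} (hK : K ∈ 𝒦) :
    (fun y => if y ∈ K then (1 : ℂ) else 0) ∈ constFun 𝒦 := by
  intro L hL a ha b hb
  by_cases hLK : L = K
  · subst hLK
    simp [ha, hb]
  · have : ∀ y ∈ L, y ∉ K := fun y hy hyK => hLK (h𝒦.eq_of_mem hL hK hy hyK)
    simp [this a ha, this b hb]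

theorem finrank_constFun {G : Type} [Finite G] {𝒦 : Set (Set G)}
    (h𝒦 : IsPartitionOf Set.univ 𝒦) : Module.finrank ℂ (constFun 𝒦) = 𝒦.ncard := by
  choose part hpart hmem using fun g : G => h𝒦.exists_mem (Set.mem_univ g)
  let π : G → 𝒦 := fun g => ⟨part g, hpart g⟩
  have hπ : Function.Surjective π := by
    rintro ⟨K, hK⟩
    obtain ⟨g, hg⟩ := h𝒦.nonempty hK
    exact ⟨g, Subtype.ext (h𝒦.eq_of_mem (hpart g) hK (hmem g) hg)⟩
  have hr : constFun 𝒦 = LinearMap.range (LinearMap.funLeft ℂ ℂ π) := by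
    ext θ
    constructor
    · intro hθ
      refine ⟨fun K => θ (h𝒦.nonempty K.2).some, ?_⟩
      ext g
      exact hθ _ (hpart g) _ (h𝒦.nonempty (hpart g)).some_mem _ (hmem g)
    · rintro ⟨φ, rfl⟩ K hK g hg h hh
      have : π g = π h := Subtype.ext ((h𝒦.eq_of_mem (hpart g) hK (hmem g) hg).trans
        (h𝒦.eq_of_mem (hpart h) hK (hmem h) hh).symm)
      simp [LinearMap.funLeft_apply, this]
  have := Fintype.ofFinite 𝒦
  rw [hr, LinearMap.finrank_range_of_inj (LinearMap.funLeft_injective_of_surjective ℂ ℂ π hπ),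
    Module.finrank_fintype_fun_eq_card, Fintype.card_eq_nat_card, Nat.card_coe_set_eq]

end Partition

section Span

variable {G : Type} [Group G] [Finite G] {𝒳 : Set (Set (G → ℂ))} {𝒦 : Set (Set G)}

theorem finrank_span_sigmaChar (h𝒳 : IsPartitionOf (Irr G) 𝒳) :
    Module.finrank ℂ (Submodule.span ℂ (sigmaChar '' 𝒳)) = 𝒳.ncard := by
  have : Fintype 𝒳 := (h𝒳.finite (Irr.finite G)).fintype
  have hli : LinearIndependent ℂ fun X : 𝒳 => sigmaChar X.1 := by
    rw [Fintype.linearIndependent_iff]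
    intro c hc X
    obtain ⟨χ, hχ⟩ := h𝒳.nonempty X.2
    have hχi := h𝒳.2.1 X.1 X.2 hχ
    have h1 := congrArg (cInnerLin G χ) hc
    rw [map_sum, map_zero, Finset.sum_eq_single X] at h1
    · rw [map_smul, cInnerLin_apply, cInner_sigmaChar (h𝒳.2.1 _ X.2) hχi, if_pos hχ] at h1
      exact (smul_eq_zero.1 h1).resolve_right (Irr.one_ne_zero hχi)
    · intro Y _ hY
      rw [map_smul, cInnerLin_apply, cInner_sigmaChar (h𝒳.2.1 _ Y.2) hχi, if_neg, smul_zero]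
      exact fun h => hY (Subtype.ext (h𝒳.eq_of_mem Y.2 X.2 h hχ))
    · exact fun h => absurd (Finset.mem_univ _) h
  rw [Set.image_eq_range, finrank_span_eq_card hli, Fintype.card_eq_nat_card, Nat.card_coe_set_eq]

theorem IsSCT.mem_span (h : IsSCT G 𝒳 𝒦) {θ : G → ℂ} (hθ : θ ∈ constFun 𝒦) :
    θ ∈ Submodule.span ℂ (sigmaChar '' 𝒳) := by
  have hle : Submodule.span ℂ (sigmaChar '' 𝒳) ≤ constFun 𝒦 := by
    rw [Submodule.span_le]
    rintro _ ⟨X, hX, rfl⟩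
    exact h.2.2.2.2 X hX
  rwa [Submodule.eq_of_le_of_finrank_eq hle
    (by rw [finrank_span_sigmaChar h.1, finrank_constFun h.2.1, h.2.2.1])]

theorem IsSCT.of_le_span (h𝒳 : IsPartitionOf (Irr G) 𝒳) (h𝒦 : IsPartitionOf Set.univ 𝒦)
    (h1 : {1} ∈ 𝒦) (hσ : ∀ X ∈ 𝒳, sigmaChar X ∈ constFun 𝒦)
    (hspan : ∀ θ ∈ constFun 𝒦, θ ∈ Submodule.span ℂ (sigmaChar '' 𝒳)) : IsSCT G 𝒳 𝒦 := by
  refine ⟨h𝒳, h𝒦, ?_, h1, hσ⟩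
  have heq : Submodule.span ℂ (sigmaChar '' 𝒳) = constFun 𝒦 := by
    refine le_antisymm (Submodule.span_le.2 ?_) hspan
    rintro _ ⟨X, hX, rfl⟩
    exact hσ X hX
  rw [← finrank_span_sigmaChar h𝒳, ← finrank_constFun h𝒦, heq]

theorem isClassFun_of_mem_span (h𝒳 : IsPartitionOf (Irr G) 𝒳) {θ : G → ℂ}
    (hθ : θ ∈ Submodule.span ℂ (sigmaChar '' 𝒳)) : IsClassFun θ := by
  induction hθ using Submodule.span_induction with
  | mem x hx =>
    obtain ⟨X, hX, rfl⟩ := hx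
    exact sigmaChar_isClassFun (h𝒳.2.1 X hX)
  | zero => exact fun _ _ => rfl
  | add x y _ _ hx hy => exact fun g h => by simp [hx g h, hy g h]
  | smul a x _ hx => exact fun g h => by simp [hx g h]

theorem exists_cInner_eq_of_mem_span (h𝒳 : IsPartitionOf (Irr G) 𝒳) {θ : G → ℂ}
    (hθ : θ ∈ Submodule.span ℂ (sigmaChar '' 𝒳)) {X : Set (G → ℂ)} (hX : X ∈ 𝒳) :
    ∃ a : ℂ, ∀ χ ∈ X, cInner G θ χ = a * χ 1 := by
  induction hθ using Submodule.span_induction with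
  | mem x hx =>
    obtain ⟨Y, hY, rfl⟩ := hx
    refine ⟨if Y = X then 1 else 0, fun χ hχ => ?_⟩
    rw [cInner_sigmaChar (h𝒳.2.1 Y hY) (h𝒳.2.1 X hX hχ)]
    by_cases hXY : Y = X
    · simp [hXY, hχ]
    · rw [if_neg hXY, if_neg fun h => hXY (h𝒳.eq_of_mem hY hX h hχ), zero_mul]
  | zero => exact ⟨0, fun χ _ => by rw [← cInnerLin_apply, map_zero, zero_mul]⟩
  | add x y _ _ hx hy =>
    obtain ⟨a, ha⟩ := hx
    obtain ⟨b, hb⟩ := hy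
    refine ⟨a + b, fun χ hχ => ?_⟩
    rw [← cInnerLin_apply, map_add, cInnerLin_apply, cInnerLin_apply, ha χ hχ, hb χ hχ, add_mul]
  | smul c x _ hx =>
    obtain ⟨a, ha⟩ := hx
    refine ⟨c * a, fun χ hχ => ?_⟩
    rw [← cInnerLin_apply, map_smul, cInnerLin_apply, ha χ hχ, smul_eq_mul, mul_assoc]

theorem IsClassFun.mem_span_sigmaChar (h𝒳 : IsPartitionOf (Irr G) 𝒳) {θ : G → ℂ}
    (hθ : IsClassFun θ) (h : ∀ X ∈ 𝒳, ∃ a : ℂ, ∀ χ ∈ X, cInner G θ χ = a * χ 1) :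
    θ ∈ Submodule.span ℂ (sigmaChar '' 𝒳) := by
  choose! a ha using h
  have hfin := h𝒳.finite (Irr.finite G)
  have heq : θ = ∑ X ∈ hfin.toFinset, a X • sigmaChar X := by
    refine hθ.ext_cInner (IsClassFun.sum_smul fun X hX =>
      sigmaChar_isClassFun (h𝒳.2.1 X (hfin.mem_toFinset.1 hX))) fun χ hχ => ?_
    obtain ⟨X, hX, hχX⟩ := h𝒳.exists_mem hχ
    rw [← cInnerLin_apply (∑ X ∈ hfin.toFinset, a X • sigmaChar X), map_sum,
      Finset.sum_eq_single X]
    · rw [map_smul, cInnerLin_apply, cInner_sigmaChar (h𝒳.2.1 X hX) hχ, if_pos hχX, ha X hX χ hχX,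
        smul_eq_mul]
    · intro Y hY hne
      have hY' := hfin.mem_toFinset.1 hY
      rw [map_smul, cInnerLin_apply, cInner_sigmaChar (h𝒳.2.1 Y hY') hχ,
        if_neg fun h => hne (h𝒳.eq_of_mem hY' hX h hχX), smul_zero]
    · exact fun h => absurd (hfin.mem_toFinset.2 hX) h
  rw [heq]
  exact Submodule.sum_mem _ fun X hX => Submodule.smul_mem _ _
    (Submodule.subset_span ⟨X, hfin.mem_toFinset.1 hX, rfl⟩)

theorem IsSCT.isClassFun (h : IsSCT G 𝒳 𝒦) {θ : G → ℂ} (hθ : θ ∈ constFun 𝒦) : IsClassFun θ :=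
  isClassFun_of_mem_span h.1 (h.mem_span hθ)

/-- A part of `𝒳` is either contained in or disjoint from the support of the Fourier transform
of a function that is constant on superclasses. -/
theorem IsSCT.cInner_ne_zero (h : IsSCT G 𝒳 𝒦) {θ : G → ℂ} (hθ : θ ∈ constFun 𝒦)
    {X : Set (G → ℂ)} (hX : X ∈ 𝒳) {χ χ' : G → ℂ} (hχ : χ ∈ X) (hχ' : χ' ∈ X)
    (hne : cInner G θ χ ≠ 0) : cInner G θ χ' ≠ 0 := by
  obtain ⟨a, ha⟩ := exists_cInner_eq_of_mem_span h.1 (h.mem_span hθ) hX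
  rw [ha χ hχ] at hne
  rw [ha χ' hχ']
  exact mul_ne_zero (left_ne_zero_of_mul hne) (Irr.one_ne_zero (h.1.2.1 X hX hχ'))

theorem IsSCT.conj_mem (h : IsSCT G 𝒳 𝒦) {K : Set G} (hK : K ∈ 𝒦) {g : G} (hg : g ∈ K) (x : G) :
    x * g * x⁻¹ ∈ K := by
  by_contra hc
  have := h.isClassFun (h.2.1.indicator_mem_constFun hK) g x
  simp [hc, hg] at this

end Span
end

noncomputable section

open scoped ComplexOrder

section Restriction

variable {G : Type} [Group G] (N : Subgroup G)

/-- Restriction of functions to a subgroup as a linear map. -/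
def resLin : (G → ℂ) →ₗ[ℂ] (N → ℂ) := LinearMap.funLeft ℂ ℂ Subtype.val

theorem resLin_apply (θ : G → ℂ) : resLin N θ = resChar N θ := rfl

theorem IsClassFun.res {θ : G → ℂ} (hθ : IsClassFun θ) : IsClassFun (resChar N θ) :=
  fun g h => hθ g h

theorem zeroExtend_apply_coe (φ : N → ℂ) (n : N) : zeroExtend N φ n = φ n := by
  simp [zeroExtend]

theorem zeroExtend_of_notMem (φ : N → ℂ) {g : G} (hg : g ∉ N) : zeroExtend N φ g = 0 := by
  simp [zeroExtend, hg]

theorem resChar_zeroExtend (φ : N → ℂ) : resChar N (zeroExtend N φ) = φ :=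
  funext (zeroExtend_apply_coe N φ)

theorem sum_eq_sum_subgroup [Fintype G] [Fintype N] {f : G → ℂ} (hf : ∀ g ∉ N, f g = 0) :
    ∑ g : G, f g = ∑ n : N, f n := by
  rw [← Finset.sum_subtype {g | g ∈ N} (by simp) f, Finset.sum_filter]
  exact Finset.sum_congr rfl fun g _ => by
    by_cases hg : g ∈ N
    · simp [hg]
    · simp [hg, hf g hg]

/-- The indicator function of a subgroup. -/
def indicatorFun : G → ℂ := zeroExtend N 1

theorem indicatorFun_isClassFun [hN : N.Normal] : IsClassFun (indicatorFun N) := fun g h => by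
  have := hN.mem_comm_iff (a := h * g) (b := h⁻¹)
  simp only [indicatorFun, zeroExtend]
  simp at this
  simp [this]

theorem IrrOver.res_eq {χ : G → ℂ} (hχ : χ ∈ IrrOver N) : resChar N χ = χ 1 • (1 : N → ℂ) := by
  ext n
  simpa [resChar] using hχ.2 n n.2

variable [Finite G]

theorem cInner_of_support {θ : G → ℂ} (hθ : ∀ g ∉ N, θ g = 0) (χ : G → ℂ) :
    cInner G θ χ =
      (Nat.card N : ℂ) / Nat.card G * cInner N (resChar N θ) (resChar N χ) := by
  have := Fintype.ofFinite G
  have := Fintype.ofFinite N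
  rw [cInner_eq_sum, cInner_eq_sum, sum_eq_sum_subgroup N fun g hg => by rw [hθ g hg, zero_mul]]
  have := card_ne_zero_complex N
  have := card_ne_zero_complex G
  simp only [resChar]
  field_simp

theorem Irr.one_pos {χ : G → ℂ} (hχ : χ ∈ Irr G) : 0 < χ 1 := by
  obtain ⟨n, hn, h⟩ := Irr.exists_degree hχ
  rw [h]
  exact_mod_cast hn

theorem Irr.cInner_res_nonneg {χ : G → ℂ} (hχ : χ ∈ Irr G) {ψ : N → ℂ} (hψ : ψ ∈ Irr N) :
    0 ≤ cInner N (resChar N χ) ψ := by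
  obtain ⟨n, h⟩ := Irr.exists_cInner_res_eq_nat hχ N hψ
  rw [h]
  exact_mod_cast n.zero_le

theorem cInner_res_sigmaChar {X : Set (G → ℂ)} (hX : X ⊆ Irr G) (ψ : N → ℂ) :
    cInner N (resChar N (sigmaChar X)) ψ =
      ∑ χ ∈ irrFin G with χ ∈ X, χ 1 * cInner N (resChar N χ) ψ := by
  rw [sigmaChar_eq_sum hX, ← resLin_apply, ← cInnerLin_apply, map_sum, map_sum]
  simp only [map_smul, smul_eq_mul, cInnerLin_apply, resLin_apply]

theorem cInner_res_sigmaChar_nonneg {X : Set (G → ℂ)} (hX : X ⊆ Irr G) {ψ : N → ℂ}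
    (hψ : ψ ∈ Irr N) : 0 ≤ cInner N (resChar N (sigmaChar X)) ψ := by
  rw [cInner_res_sigmaChar N hX]
  refine Finset.sum_nonneg fun χ hχ => ?_
  have hχ' := mem_irrFin.1 (Finset.mem_filter.1 hχ).1
  exact mul_nonneg (Irr.one_pos hχ').le (Irr.cInner_res_nonneg N hχ' hψ)

theorem mem_constituentsOn_sigmaChar {X : Set (G → ℂ)} (hX : X ⊆ Irr G) {ψ : N → ℂ} :
    ψ ∈ constituentsOn N (sigmaChar X) ↔
      ψ ∈ Irr N ∧ ∃ χ ∈ X, cInner N (resChar N χ) ψ ≠ 0 := by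
  refine and_congr_right fun hψ => ?_
  rw [← not_iff_not, not_not, cInner_res_sigmaChar N hX, Finset.sum_eq_zero_iff_of_nonneg]
  · push Not
    constructor
    · intro h χ hχ
      exact (mul_eq_zero.1 (h χ (Finset.mem_filter.2 ⟨mem_irrFin.2 (hX hχ), hχ⟩))).resolve_left
        (Irr.one_ne_zero (hX hχ))
    · intro h χ hχ
      rw [h χ (Finset.mem_filter.1 hχ).2, mul_zero]
  · intro χ hχ
    have hχ' := mem_irrFin.1 (Finset.mem_filter.1 hχ).1
    exact mul_nonneg (Irr.one_pos hχ').le (Irr.cInner_res_nonneg N hχ' hψ)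

theorem cInner_ne_zero_iff_exists_common {α β : G → ℂ} (hα : IsClassFun α)
    (hα0 : ∀ ψ ∈ Irr G, 0 ≤ cInner G α ψ) (hβ0 : ∀ ψ ∈ Irr G, 0 ≤ cInner G β ψ) :
    cInner G α β ≠ 0 ↔ ∃ ψ ∈ Irr G, cInner G α ψ ≠ 0 ∧ cInner G β ψ ≠ 0 := by
  have hconj : ∀ ψ ∈ Irr G, (starRingEnd ℂ) (cInner G β ψ) = cInner G β ψ := fun ψ hψ =>
    Complex.conj_eq_iff_im.2 (Complex.nonneg_iff.1 (hβ0 ψ hψ)).2.symm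
  rw [hα.parseval, ← not_iff_not, not_not, Finset.sum_eq_zero_iff_of_nonneg]
  · push Not
    refine forall_congr' fun ψ => ?_
    rw [mem_irrFin]
    refine forall_congr' fun hψ => ?_
    rw [hconj ψ hψ, mul_eq_zero, or_iff_not_imp_left]
  · intro ψ hψ
    have hψ' := mem_irrFin.1 hψ
    rw [hconj ψ hψ']
    exact mul_nonneg (hα0 ψ hψ') (hβ0 ψ hψ')

theorem Irr.exists_constituent {χ : G → ℂ} (hχ : χ ∈ Irr G) :
    ∃ ψ ∈ Irr N, cInner N (resChar N χ) ψ ≠ 0 :=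
  ((Irr.isClassFun hχ).res N).exists_cInner_ne_zero fun h => Irr.one_ne_zero hχ (congrFun h 1)

theorem Irr.exists_over {ψ : N → ℂ} (hψ : ψ ∈ Irr N) :
    ∃ χ ∈ Irr G, cInner N (resChar N χ) ψ ≠ 0 := by
  by_contra! hc
  have := Fintype.ofFinite N
  let δ : G → ℂ := fun g => if g = 1 then 1 else 0
  have hδ : IsClassFun δ := fun g h => by simp [δ]
  have h1 : cInner N (resChar N δ) ψ = 0 := by
    rw [hδ.eq_sum, ← resLin_apply, ← cInnerLin_apply, map_sum, map_sum]
    refine Finset.sum_eq_zero fun χ hχ => ?_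
    rw [map_smul, map_smul, cInnerLin_apply, resLin_apply, hc χ (mem_irrFin.1 hχ), smul_zero]
  rw [cInner_eq_sum, Finset.sum_eq_single (1 : N)] at h1
  · simp [δ, resChar, Irr.one_ne_zero hψ] at h1
  · intro n _ hn
    simp [δ, resChar, hn]
  · simp

/-- The central character of a class function supported on `N` takes the same value at `χ` and at
every constituent of the restriction of `χ`. -/
theorem Irr.centralChar_eq {θ χ : G → ℂ} (hθ : IsClassFun θ) (hsupp : ∀ g ∉ N, θ g = 0)
    (hχ : χ ∈ Irr G) {ψ : N → ℂ} (hψ : ψ ∈ Irr N) (hne : cInner N (resChar N χ) ψ ≠ 0) :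
    (Nat.card N : ℂ) * cInner N (resChar N θ) ψ / ψ 1 = Nat.card G * cInner G θ χ / χ 1 := by
  have := Fintype.ofFinite G
  have := Fintype.ofFinite N
  let θ' : G → ℂ := fun g => (starRingEnd ℂ) (θ g)
  have hθ' : IsClassFun θ' := fun g h => by simp only [θ', hθ g h]
  let T : (N → ℂ) →ₗ[ℂ] (N → ℂ) := ∑ n : N, θ' n • LinearMap.funLeft ℂ ℂ (n * ·)
  have hT : ∀ α x, T α x = ∑ n : N, θ' n * α (n * x) := fun α x => by
    simp [T, LinearMap.funLeft_apply]
  have hψT : ∀ ψ ∈ Irr N, T ψ = ((∑ n : N, θ' n * ψ n) / ψ 1) • ψ := fun ψ hψ => by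
    ext x
    rw [hT]
    exact Irr.convolution hψ (hθ'.res N) x
  have hχT : T (resChar N χ) = ((∑ g : G, θ' g * χ g) / χ 1) • resChar N χ := by
    ext x
    rw [hT, Pi.smul_apply, smul_eq_mul, resChar, ← Irr.convolution hχ hθ',
      sum_eq_sum_subgroup N fun g hg => by simp [θ', hsupp g hg]]
    rfl
  have hkey : (∑ n : N, θ' n * ψ n) / ψ 1 = (∑ g : G, θ' g * χ g) / χ 1 := by
    have h1 := congrArg (cInnerLin N ψ) hχT
    conv_lhs at h1 => rw [((Irr.isClassFun hχ).res N).eq_sum, map_sum]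
    rw [Finset.sum_congr rfl fun φ hφ => by rw [map_smul, hψT φ (mem_irrFin.1 hφ), smul_smul],
      cInnerLin_apply, Irr.cInner_sum_smul (fun φ hφ => mem_irrFin.1 hφ) hψ,
      if_pos (mem_irrFin.2 hψ), map_smul, cInnerLin_apply, smul_eq_mul, mul_comm] at h1
    exact mul_right_cancel₀ hne h1
  have hconj := congrArg (starRingEnd ℂ) hkey
  obtain ⟨a, -, ha⟩ := Irr.exists_degree hψ
  obtain ⟨b, -, hb⟩ := Irr.exists_degree hχ
  simp only [map_div₀, map_sum, map_mul, θ', Complex.conj_conj, ha, hb, Complex.conj_natCast]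
    at hconj
  rw [cInner_eq_sum, cInner_eq_sum, mul_inv_cancel_left₀ (card_ne_zero_complex N),
    mul_inv_cancel_left₀ (card_ne_zero_complex G), ha, hb]
  exact hconj

theorem IrrOver.eq_one {χ : G → ℂ} (hχ : χ ∈ IrrOver N) {ψ : N → ℂ} (hψ : ψ ∈ Irr N)
    (hne : cInner N (resChar N χ) ψ ≠ 0) : ψ = 1 := by
  rw [IrrOver.res_eq N hχ, ← cInnerLin_apply, map_smul, cInnerLin_apply,
    Irr.cInner_eq (one_mem_Irr N) hψ] at hne
  by_contra h
  simp [Ne.symm h] at hne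

variable [N.Normal]

theorem mem_IrrOver_iff {χ : G → ℂ} (hχ : χ ∈ Irr G) :
    χ ∈ IrrOver N ↔ cInner N (resChar N χ) 1 ≠ 0 := by
  constructor
  · intro h
    rw [IrrOver.res_eq N h, ← cInnerLin_apply, map_smul, cInnerLin_apply,
      Irr.cInner_self (one_mem_Irr N)]
    simpa using Irr.one_ne_zero hχ
  · intro h
    have h0 : ∀ ψ ∈ irrFin N, ψ ≠ 1 → cInner N (resChar N χ) ψ = 0 := by
      intro ψ hψ hne
      rw [mem_irrFin] at hψ
      by_contra hc
      have hsupp : ∀ g ∉ N, indicatorFun N g = 0 := fun g => zeroExtend_of_notMem N 1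
      have h1 := Irr.centralChar_eq N (indicatorFun_isClassFun N) hsupp hχ hψ hc
      rw [← Irr.centralChar_eq N (indicatorFun_isClassFun N) hsupp hχ (one_mem_Irr N) h,
        indicatorFun, resChar_zeroExtend, Irr.cInner_eq (one_mem_Irr N) hψ, if_neg hne.symm,
        Irr.cInner_self (one_mem_Irr N)] at h1
      simp at h1
      exact card_ne_zero_complex N h1.symm
    have h1 := ((Irr.isClassFun hχ).res N).eq_sum
    rw [Finset.sum_eq_single (1 : N → ℂ) (fun ψ hψ hne => by rw [h0 ψ hψ hne, zero_smul])
      (fun hc => absurd (mem_irrFin.2 (one_mem_Irr N)) hc)] at h1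
    refine ⟨hχ, fun n hn => ?_⟩
    have h2 := congrFun h1 ⟨n, hn⟩
    have h3 := congrFun h1 1
    exact h2.trans h3.symm

end Restriction
end

noncomputable section

open scoped ComplexOrder

section RestrictedTheory

variable {G : Type} [Group G] {𝒳 : Set (Set (G → ℂ))} {𝒦 : Set (Set G)} {N : Subgroup G}

theorem CNormal.subset_of_mem (hCN : CNormal 𝒦 N) (h𝒦 : IsPartitionOf Set.univ 𝒦) {K : Set G}
    (hK : K ∈ 𝒦) {g : G} (hg : g ∈ K) (hgN : g ∈ N) : K ⊆ N := by
  obtain ⟨T, hT, hNT⟩ := hCN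
  have hg' : g ∈ ⋃₀ T := hNT ▸ hgN
  obtain ⟨L, hL, hgL⟩ := hg'
  rw [h𝒦.eq_of_mem hK (hT hL) hg hgL, hNT]
  exact Set.subset_sUnion_of_mem hL

/-- The members of `𝒦` contained in `N`, as subsets of `N`. -/
abbrev classesIn (𝒦 : Set (Set G)) (N : Subgroup G) : Set (Set N) :=
  (fun K => (Subtype.val ⁻¹' K : Set N)) '' {K ∈ 𝒦 | K ⊆ (N : Set G)}

/-- The sets of irreducible constituents of the restrictions of the `σ_X`. -/
abbrev charsOn (𝒳 : Set (Set (G → ℂ))) (N : Subgroup G) : Set (Set (N → ℂ)) :=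
  (fun X => constituentsOn N (sigmaChar X)) '' 𝒳

theorem res_mem_constFun {θ : G → ℂ} (hθ : θ ∈ constFun 𝒦) :
    resChar N θ ∈ constFun (classesIn 𝒦 N) := by
  rintro _ ⟨K, ⟨hK, -⟩, rfl⟩ g hg h hh
  exact hθ K hK g hg h hh

theorem zeroExtend_mem_constFun (hCN : CNormal 𝒦 N) (h𝒦 : IsPartitionOf Set.univ 𝒦) {φ : N → ℂ}
    (hφ : φ ∈ constFun (classesIn 𝒦 N)) : zeroExtend N φ ∈ constFun 𝒦 := by
  intro K hK g hg h hh
  by_cases hgN : g ∈ N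
  · have hKN := hCN.subset_of_mem h𝒦 hK hg hgN
    have := hφ _ ⟨K, ⟨hK, hKN⟩, rfl⟩ ⟨g, hgN⟩ hg ⟨h, hKN hh⟩ hh
    exact (zeroExtend_apply_coe N φ ⟨g, hgN⟩).trans
      (this.trans (zeroExtend_apply_coe N φ ⟨h, hKN hh⟩).symm)
  · rw [zeroExtend_of_notMem N φ hgN,
      zeroExtend_of_notMem N φ fun hhN => hgN (hCN.subset_of_mem h𝒦 hK hh hhN hg)]

theorem indicatorFun_mem_constFun (h𝒦 : IsPartitionOf Set.univ 𝒦) (hCN : CNormal 𝒦 N) :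
    indicatorFun N ∈ constFun 𝒦 :=
  zeroExtend_mem_constFun hCN h𝒦 fun _ _ _ _ _ _ => rfl

theorem isPartitionOf_classesIn (hCN : CNormal 𝒦 N) (h𝒦 : IsPartitionOf Set.univ 𝒦) :
    IsPartitionOf Set.univ (classesIn 𝒦 N) := by
  refine .of_eq_of_mem ?_ (fun _ _ => Set.subset_univ _) ?_ ?_
  · rintro _ ⟨K, ⟨hK, hKN⟩, rfl⟩
    obtain ⟨g, hg⟩ := h𝒦.nonempty hK
    exact ⟨⟨g, hKN hg⟩, hg⟩
  · intro n _
    obtain ⟨K, hK, hn⟩ := h𝒦.exists_mem (Set.mem_univ (n : G))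
    exact ⟨_, ⟨K, ⟨hK, hCN.subset_of_mem h𝒦 hK hn n.2⟩, rfl⟩, hn⟩
  · rintro _ ⟨K, ⟨hK, -⟩, rfl⟩ _ ⟨L, ⟨hL, -⟩, rfl⟩ n hn hn'
    rw [h𝒦.eq_of_mem hK hL hn hn']

variable [Finite G]

theorem IsSCT.isClassFun_of_mem_classesIn (h : IsSCT G 𝒳 𝒦) (hCN : CNormal 𝒦 N) {φ : N → ℂ}
    (hφ : φ ∈ constFun (classesIn 𝒦 N)) : IsClassFun φ := by
  rw [← resChar_zeroExtend N φ]
  exact (h.isClassFun (zeroExtend_mem_constFun hCN h.2.1 hφ)).res N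

theorem IsSCT.exists_cInner_eq_on_constituents (h : IsSCT G 𝒳 𝒦) (hCN : CNormal 𝒦 N) {φ : N → ℂ}
    (hφ : φ ∈ constFun (classesIn 𝒦 N)) {X : Set (G → ℂ)} (hX : X ∈ 𝒳) :
    ∃ b : ℂ, ∀ ψ ∈ constituentsOn N (sigmaChar X), cInner N φ ψ = b * ψ 1 := by
  have hθ := zeroExtend_mem_constFun hCN h.2.1 hφ
  obtain ⟨a, ha⟩ := exists_cInner_eq_of_mem_span h.1 (h.mem_span hθ) hX
  refine ⟨Nat.card G * a / Nat.card N, fun ψ hψ => ?_⟩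
  obtain ⟨hψi, χ, hχ, hne⟩ := (mem_constituentsOn_sigmaChar N (h.1.2.1 X hX)).1 hψ
  have hχi := h.1.2.1 X hX hχ
  have h1 := Irr.centralChar_eq N (h.isClassFun hθ) (fun g => zeroExtend_of_notMem N φ) hχi hψi hne
  rw [resChar_zeroExtend, ha χ hχ] at h1
  have := Irr.one_ne_zero hχi
  have := Irr.one_ne_zero hψi
  have := card_ne_zero_complex N
  field_simp at h1 ⊢
  linear_combination h1

theorem IsSCT.res_sigmaChar_mem (h : IsSCT G 𝒳 𝒦) {X : Set (G → ℂ)} (hX : X ∈ 𝒳) :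
    resChar N (sigmaChar X) ∈ constFun (classesIn 𝒦 N) :=
  res_mem_constFun (h.2.2.2.2 X hX)

theorem IsSCT.constituentsOn_subset (h : IsSCT G 𝒳 𝒦) (hCN : CNormal 𝒦 N) {X Y : Set (G → ℂ)}
    (hX : X ∈ 𝒳) (hY : Y ∈ 𝒳) {ψ : N → ℂ} (hψX : ψ ∈ constituentsOn N (sigmaChar X))
    (hψY : ψ ∈ constituentsOn N (sigmaChar Y)) :
    constituentsOn N (sigmaChar Y) ⊆ constituentsOn N (sigmaChar X) := by
  obtain ⟨b, hb⟩ := h.exists_cInner_eq_on_constituents hCN (h.res_sigmaChar_mem hX) hY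
  have hb0 : b ≠ 0 := left_ne_zero_of_mul (hb ψ hψY ▸ hψX.2)
  exact fun φ hφ => ⟨hφ.1, hb φ hφ ▸ mul_ne_zero hb0 (Irr.one_ne_zero hφ.1)⟩

theorem IsSCT.isPartitionOf_charsOn (h : IsSCT G 𝒳 𝒦) (hCN : CNormal 𝒦 N) :
    IsPartitionOf (Irr N) (charsOn 𝒳 N) := by
  refine .of_eq_of_mem ?_ ?_ ?_ ?_
  · rintro _ ⟨X, hX, rfl⟩
    obtain ⟨χ, hχ⟩ := h.1.nonempty hX
    obtain ⟨ψ, hψ, hne⟩ := Irr.exists_constituent N (h.1.2.1 X hX hχ)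
    exact ⟨ψ, (mem_constituentsOn_sigmaChar N (h.1.2.1 X hX)).2 ⟨hψ, χ, hχ, hne⟩⟩
  · rintro _ ⟨X, hX, rfl⟩ ψ hψ
    exact hψ.1
  · intro ψ hψ
    obtain ⟨χ, hχ, hne⟩ := Irr.exists_over N hψ
    obtain ⟨X, hX, hχX⟩ := h.1.exists_mem hχ
    exact ⟨_, ⟨X, hX, rfl⟩, (mem_constituentsOn_sigmaChar N (h.1.2.1 X hX)).2 ⟨hψ, χ, hχX, hne⟩⟩
  · rintro _ ⟨X, hX, rfl⟩ _ ⟨Y, hY, rfl⟩ ψ hψX hψY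
    exact (h.constituentsOn_subset hCN hY hX hψY hψX).antisymm
      (h.constituentsOn_subset hCN hX hY hψX hψY)

/-- The restriction to a `𝒞`-normal subgroup of a supercharacter theory. -/
theorem IsSCT.restrict (h : IsSCT G 𝒳 𝒦) (hCN : CNormal 𝒦 N) :
    IsSCT N (charsOn 𝒳 N) (classesIn 𝒦 N) := by
  have hpart := h.isPartitionOf_charsOn hCN
  refine .of_le_span hpart (isPartitionOf_classesIn hCN h.2.1) ?_ ?_ ?_
  · refine ⟨{1}, ⟨h.2.2.2.1, by simp⟩, ?_⟩
    ext n
    simp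
  · rintro _ ⟨X, hX, rfl⟩
    obtain ⟨b, hb⟩ := h.exists_cInner_eq_on_constituents hCN (h.res_sigmaChar_mem hX) hX
    have hmem : constituentsOn N (sigmaChar X) ∈ charsOn 𝒳 N := ⟨X, hX, rfl⟩
    obtain ⟨ψ, hψ⟩ := hpart.nonempty hmem
    have hb0 : b ≠ 0 := left_ne_zero_of_mul (hb ψ hψ ▸ hψ.2)
    have hsub := hpart.2.1 _ hmem
    have heq : sigmaChar (constituentsOn N (sigmaChar X)) = b⁻¹ • resChar N (sigmaChar X) := by
      refine (sigmaChar_isClassFun hsub).ext_cInner ?_ fun φ hφ => ?_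
      · exact h.isClassFun_of_mem_classesIn hCN
          (Submodule.smul_mem _ _ (h.res_sigmaChar_mem hX))
      · rw [cInner_sigmaChar hsub hφ, ← cInnerLin_apply, map_smul, cInnerLin_apply, smul_eq_mul]
        split_ifs with hc
        · rw [hb φ hc, inv_mul_cancel_left₀ hb0]
        · rw [not_not.1 fun hne => hc ⟨hφ, hne⟩, mul_zero]
    change sigmaChar (constituentsOn N (sigmaChar X)) ∈ _
    rw [heq]
    exact Submodule.smul_mem _ _ (h.res_sigmaChar_mem hX)
  · intro φ hφ
    refine (h.isClassFun_of_mem_classesIn hCN hφ).mem_span_sigmaChar hpart ?_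
    rintro _ ⟨X, hX, rfl⟩
    exact h.exists_cInner_eq_on_constituents hCN hφ hX

theorem IsSCT.conjSub_image (h : IsSCT G 𝒳 𝒦) (hN : N.Normal) (g : G) {K' : Set N}
    (hK' : K' ∈ classesIn 𝒦 N) : conjSub hN g '' K' = K' := by
  obtain ⟨K, ⟨hK, -⟩, rfl⟩ := hK'
  ext n
  constructor
  · rintro ⟨m, hm, rfl⟩
    exact h.conj_mem hK hm g
  · intro hn
    refine ⟨conjSub hN g⁻¹ n, h.conj_mem hK hn g⁻¹, Subtype.ext ?_⟩
    simp only [conjSub]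
    group

end RestrictedTheory
end

noncomputable section

section Average

variable {G : Type} [Group G] [Finite G] (N : Subgroup G)

/-- Averaging a function over the cosets of `N`. -/
def avg : (G → ℂ) →ₗ[ℂ] (G → ℂ) where
  toFun θ x := cInnerLin N 1 fun n => θ (n * x)
  map_add' _ _ := funext fun _ => map_add (cInnerLin N 1) _ _
  map_smul' _ _ := funext fun _ => map_smul (cInnerLin N 1) _ _

theorem avg_apply [Fintype N] (θ : G → ℂ) (x : G) :
    avg N θ x = (Nat.card N : ℂ)⁻¹ * ∑ n : N, θ (n * x) := by
  change cInner N _ 1 = _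
  simp [cInner_eq_sum]

theorem avg_eq_self {θ : G → ℂ} {x : G} (h : ∀ n : N, θ (n * x) = θ x) : avg N θ x = θ x := by
  have := Fintype.ofFinite N
  simp only [avg_apply, h, Finset.sum_const, Finset.card_univ, Fintype.card_eq_nat_card,
    nsmul_eq_mul]
  exact inv_mul_cancel_left₀ (card_ne_zero_complex N) _

variable [N.Normal]

theorem Irr.avg_eq {χ : G → ℂ} (hχ : χ ∈ Irr G) :
    avg N χ = (cInner N (resChar N χ) 1 / χ 1) • χ := by
  have := Fintype.ofFinite G
  have := Fintype.ofFinite N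
  ext x
  have h1 := Irr.convolution hχ (indicatorFun_isClassFun N) x
  rw [sum_eq_sum_subgroup N fun g hg => by rw [indicatorFun, zeroExtend_of_notMem N 1 hg, zero_mul],
    sum_eq_sum_subgroup N fun g hg => by rw [indicatorFun, zeroExtend_of_notMem N 1 hg, zero_mul]]
    at h1
  simp only [indicatorFun, zeroExtend_apply_coe, Pi.one_apply, one_mul] at h1
  rw [avg_apply, h1, Pi.smul_apply, smul_eq_mul, cInner_eq_sum]
  simp only [Pi.one_apply, map_one, mul_one, resChar]
  ring

theorem avg_of_mem_IrrOver {χ : G → ℂ} (hχ : χ ∈ IrrOver N) : avg N χ = χ := by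
  rw [Irr.avg_eq N hχ.1, IrrOver.res_eq N hχ, ← cInnerLin_apply, map_smul, cInnerLin_apply,
    Irr.cInner_self (one_mem_Irr N), smul_eq_mul, mul_one, div_self (Irr.one_ne_zero hχ.1),
    one_smul]

theorem avg_of_notMem_IrrOver {χ : G → ℂ} (hχ : χ ∈ Irr G) (h : χ ∉ IrrOver N) :
    avg N χ = 0 := by
  rw [Irr.avg_eq N hχ, not_not.1 fun hne => h ((mem_IrrOver_iff N hχ).2 hne), zero_div, zero_smul]

theorem avg_sigmaChar_of_subset {X : Set (G → ℂ)} (hX : X ⊆ IrrOver N) :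
    avg N (sigmaChar X) = sigmaChar X := by
  rw [sigmaChar_eq_sum fun χ hχ => (hX hχ).1, map_sum]
  exact Finset.sum_congr rfl fun χ hχ => by
    rw [map_smul, avg_of_mem_IrrOver N (hX (Finset.mem_filter.1 hχ).2)]

theorem avg_sigmaChar_of_disjoint {X : Set (G → ℂ)} (hX : X ⊆ Irr G)
    (hdisj : ∀ χ ∈ X, χ ∉ IrrOver N) : avg N (sigmaChar X) = 0 := by
  rw [sigmaChar_eq_sum hX, map_sum]
  exact Finset.sum_eq_zero fun χ hχ => by
    obtain ⟨hχi, hχX⟩ := Finset.mem_filter.1 hχ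
    rw [map_smul, avg_of_notMem_IrrOver N (mem_irrFin.1 hχi) (hdisj χ hχX), smul_zero]

theorem cInner_indicatorFun_ne_zero_iff {χ : G → ℂ} (hχ : χ ∈ Irr G) :
    cInner G (indicatorFun N) χ ≠ 0 ↔ χ ∈ IrrOver N := by
  rw [mem_IrrOver_iff N hχ, indicatorFun,
    cInner_of_support N (fun g => zeroExtend_of_notMem N 1) χ, resChar_zeroExtend,
    ← cInner_conj (resChar N χ), mul_ne_zero_iff, map_ne_zero]
  exact and_iff_right (div_ne_zero (card_ne_zero_complex N) (card_ne_zero_complex G))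

end Average

section QuotientTheory

variable {G : Type} [Group G] (N : Subgroup G) [N.Normal]

theorem mk_eq_mk_iff {x y : G} : (x : G ⧸ N) = y ↔ ∃ n : N, y = n * x := by
  constructor
  · intro h
    refine ⟨⟨y * x⁻¹, ?_⟩, by simp⟩
    rw [← QuotientGroup.eq_one_iff, QuotientGroup.mk_mul, QuotientGroup.mk_inv, h,
      mul_inv_cancel]
  · rintro ⟨n, rfl⟩
    rw [QuotientGroup.mk_mul, (QuotientGroup.eq_one_iff (n : G)).2 n.2, one_mul]

theorem inflateSet_deflate [Finite G] {X : Set (G → ℂ)} (hX : X ⊆ IrrOver N) :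
    inflateSet N (deflate N X) = X := by
  have key : ∀ χ ∈ X, (fun q : G ⧸ N => χ (Quotient.out q)) ∘ (QuotientGroup.mk : G → G ⧸ N) = χ := by
    intro χ hχ
    obtain ⟨η, -, rfl⟩ := IrrOver.exists_inflate N (hX hχ)
    ext g
    simp
  rw [inflateSet, deflate, Set.image_image, Set.image_congr key, Set.image_id']

theorem mem_deflate_iff [Finite G] {X : Set (G → ℂ)} (hX : X ⊆ IrrOver N) {η : G ⧸ N → ℂ} :
    η ∈ deflate N X ↔ (fun g : G => η g) ∈ X := by
  constructor
  · intro h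
    rw [← inflateSet_deflate N hX]
    exact ⟨η, h, rfl⟩
  · intro h
    refine ⟨_, h, ?_⟩
    ext q
    simp

theorem deflate_subset [Finite G] {X : Set (G → ℂ)} (hX : X ⊆ IrrOver N) :
    deflate N X ⊆ Irr (G ⧸ N) := by
  intro η hη
  obtain ⟨η', hη', h⟩ := IrrOver.exists_inflate N (hX ((mem_deflate_iff N hX).1 hη))
  rwa [QuotientGroup.mk_surjective.injective_comp_right h]

theorem sigmaChar_deflate [Finite G] {X : Set (G → ℂ)} (hX : X ⊆ IrrOver N) (g : G) :
    sigmaChar (deflate N X) (g : G ⧸ N) = sigmaChar X g := by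
  conv_rhs => rw [← inflateSet_deflate N hX, sigmaChar, inflateSet,
    finsum_mem_image QuotientGroup.mk_surjective.injective_comp_right.injOn]
  rfl

theorem cInner_quotient [Finite G] (α β : G ⧸ N → ℂ) :
    cInner (G ⧸ N) α β = cInner G (fun g : G => α g) fun g : G => β g := by
  have := Fintype.ofFinite G
  have := Fintype.ofFinite (G ⧸ N)
  rw [cInner_eq_sum, cInner_eq_sum, sum_comp_mk N fun q => α q * (starRingEnd ℂ) (β q),
    Subgroup.card_eq_card_quotient_mul_card_subgroup N, Nat.cast_mul]
  have := card_ne_zero_complex N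
  have := card_ne_zero_complex (G ⧸ N)
  field_simp

variable [Finite G] {𝒳 : Set (Set (G → ℂ))} {𝒦 : Set (Set G)} {N}

theorem IsSCT.subset_IrrOver (h : IsSCT G 𝒳 𝒦) (hCN : CNormal 𝒦 N) {X : Set (G → ℂ)}
    (hX : X ∈ 𝒳) {χ : G → ℂ} (hχ : χ ∈ X) (hχN : χ ∈ IrrOver N) : X ⊆ IrrOver N := fun _ hχ' =>
  (cInner_indicatorFun_ne_zero_iff N (h.1.2.1 X hX hχ')).1
    (h.cInner_ne_zero (indicatorFun_mem_constFun h.2.1 hCN) hX hχ hχ'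
      ((cInner_indicatorFun_ne_zero_iff N hχN.1).2 hχN))

theorem IsSCT.avg_mem (h : IsSCT G 𝒳 𝒦) (hCN : CNormal 𝒦 N) {θ : G → ℂ}
    (hθ : θ ∈ constFun 𝒦) : avg N θ ∈ constFun 𝒦 := by
  suffices Submodule.span ℂ (sigmaChar '' 𝒳) ≤ (constFun 𝒦).comap (avg N) from
    this (h.mem_span hθ)
  rw [Submodule.span_le]
  rintro _ ⟨X, hX, rfl⟩
  change avg N (sigmaChar X) ∈ constFun 𝒦
  by_cases hXN : ∃ χ ∈ X, χ ∈ IrrOver N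
  · obtain ⟨χ, hχ, hχN⟩ := hXN
    rw [avg_sigmaChar_of_subset N (h.subset_IrrOver hCN hX hχ hχN)]
    exact h.2.2.2.2 X hX
  · push Not at hXN
    rw [avg_sigmaChar_of_disjoint N (h.1.2.1 X hX) hXN]
    exact Submodule.zero_mem _

theorem avg_indicator_ne_zero_iff (K : Set G) (x : G) :
    avg N (fun y => if y ∈ K then (1 : ℂ) else 0) x ≠ 0 ↔
      (x : G ⧸ N) ∈ (QuotientGroup.mk : G → G ⧸ N) '' K := by
  have := Fintype.ofFinite N
  rw [avg_apply, mul_ne_zero_iff, and_iff_right (inv_ne_zero (card_ne_zero_complex N)),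
    Finset.sum_boole, Nat.cast_ne_zero, ← Nat.pos_iff_ne_zero, Finset.card_pos]
  constructor
  · rintro ⟨n, hn⟩
    exact ⟨n * x, (Finset.mem_filter.1 hn).2, ((mk_eq_mk_iff N).2 ⟨n, rfl⟩).symm⟩
  · rintro ⟨k, hk, hkx⟩
    obtain ⟨n, rfl⟩ := (mk_eq_mk_iff N).1 hkx.symm
    exact ⟨n, by simpa using hk⟩

theorem IsSCT.image_mk_subset (h : IsSCT G 𝒳 𝒦) (hCN : CNormal 𝒦 N) {K L : Set G} (hK : K ∈ 𝒦)
    (hL : L ∈ 𝒦) {q : G ⧸ N} (hqK : q ∈ (QuotientGroup.mk : G → G ⧸ N) '' K)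
    (hqL : q ∈ (QuotientGroup.mk : G → G ⧸ N) '' L) :
    (QuotientGroup.mk : G → G ⧸ N) '' K ⊆ (QuotientGroup.mk : G → G ⧸ N) '' L := by
  obtain ⟨a, ha, rfl⟩ := hqK
  rintro _ ⟨k, hk, rfl⟩
  rw [← avg_indicator_ne_zero_iff] at hqL ⊢
  rwa [h.avg_mem hCN (h.2.1.indicator_mem_constFun hL) K hK k hk a ha]

theorem IsSCT.isPartitionOf_image_mk (h : IsSCT G 𝒳 𝒦) (hCN : CNormal 𝒦 N) :
    IsPartitionOf Set.univ ((fun K => ((QuotientGroup.mk : G → G ⧸ N) '' K)) '' 𝒦) := by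
  refine .of_eq_of_mem ?_ (fun _ _ => Set.subset_univ _) ?_ ?_
  · rintro _ ⟨K, hK, rfl⟩
    exact (h.2.1.nonempty hK).image _
  · intro q _
    obtain ⟨g, rfl⟩ := QuotientGroup.mk_surjective q
    obtain ⟨K, hK, hg⟩ := h.2.1.exists_mem (Set.mem_univ g)
    exact ⟨_, ⟨K, hK, rfl⟩, g, hg, rfl⟩
  · rintro _ ⟨K, hK, rfl⟩ _ ⟨L, hL, rfl⟩ q hq hq'
    exact (h.image_mk_subset hCN hK hL hq hq').antisymm (h.image_mk_subset hCN hL hK hq' hq)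

/-- The quotient of a supercharacter theory by a `𝒞`-normal subgroup. -/
theorem IsSCT.quotient (h : IsSCT G 𝒳 𝒦) (hCN : CNormal 𝒦 N) :
    IsSCT (G ⧸ N) (deflate N '' {X ∈ 𝒳 | X ⊆ IrrOver N})
      ((fun K => ((QuotientGroup.mk : G → G ⧸ N) '' K)) '' 𝒦) := by
  have hpart : IsPartitionOf (Irr (G ⧸ N)) (deflate N '' {X ∈ 𝒳 | X ⊆ IrrOver N}) := by
    refine .of_eq_of_mem ?_ ?_ ?_ ?_
    · rintro _ ⟨X, ⟨hX, -⟩, rfl⟩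
      exact (h.1.nonempty hX).image _
    · rintro _ ⟨X, ⟨-, hXN⟩, rfl⟩
      exact deflate_subset N hXN
    · intro η hη
      have hη' := Irr.inflate_mem N hη
      obtain ⟨X, hX, hηX⟩ := h.1.exists_mem hη'.1
      have hXN := h.subset_IrrOver hCN hX hηX hη'
      exact ⟨_, ⟨X, ⟨hX, hXN⟩, rfl⟩, (mem_deflate_iff N hXN).2 hηX⟩
    · rintro _ ⟨X, ⟨hX, hXN⟩, rfl⟩ _ ⟨Y, ⟨hY, hYN⟩, rfl⟩ η hηX hηY
      rw [h.1.eq_of_mem hX hY ((mem_deflate_iff N hXN).1 hηX) ((mem_deflate_iff N hYN).1 hηY)]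
  refine .of_le_span hpart (h.isPartitionOf_image_mk hCN) ?_ ?_ ?_
  · exact ⟨{1}, h.2.2.2.1, by simp⟩
  · rintro _ ⟨X, ⟨hX, hXN⟩, rfl⟩ _ ⟨K, hK, rfl⟩ _ ⟨a, ha, rfl⟩ _ ⟨b, hb, rfl⟩
    rw [sigmaChar_deflate N hXN, sigmaChar_deflate N hXN]
    exact h.2.2.2.2 X hX K hK a ha b hb
  · intro θ hθ
    have hθ' : (fun g : G => θ g) ∈ constFun 𝒦 := fun K hK a ha b hb =>
      hθ _ ⟨K, hK, rfl⟩ _ ⟨a, ha, rfl⟩ _ ⟨b, hb, rfl⟩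
    refine IsClassFun.mem_span_sigmaChar hpart ?_ ?_
    · intro p q
      obtain ⟨a, rfl⟩ := QuotientGroup.mk_surjective p
      obtain ⟨b, rfl⟩ := QuotientGroup.mk_surjective q
      exact h.isClassFun hθ' a b
    · rintro _ ⟨X, ⟨hX, hXN⟩, rfl⟩
      obtain ⟨a, ha⟩ := exists_cInner_eq_of_mem_span h.1 (h.mem_span hθ') hX
      refine ⟨a, fun η hη => ?_⟩
      rw [cInner_quotient]
      exact ha _ ((mem_deflate_iff N hXN).1 hη)

end QuotientTheory
end

noncomputable section

open scoped ComplexOrder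

theorem eq_partJoin {α : Type*} {P Q R : Set (Set α)} (hne : ∀ r ∈ R, r.Nonempty)
    (hsub : ∀ r ∈ R, r ⊆ ⋃₀ P) (hcov : ∀ a ∈ ⋃₀ P, ∃ r ∈ R, a ∈ r)
    (hP : ∀ r ∈ R, ∀ p ∈ P, ∀ x ∈ r, x ∈ p → p ⊆ r)
    (hQ : ∀ r ∈ R, ∀ q ∈ Q, ∀ x ∈ r, x ∈ q → q ⊆ r)
    (hconn : ∀ r ∈ R, ∀ a ∈ r, ∀ b ∈ r, Relation.ReflTransGen
      (fun x y => (∃ p ∈ P, x ∈ p ∧ y ∈ p) ∨ ∃ q ∈ Q, x ∈ q ∧ y ∈ q) a b) :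
    R = PartJoin P Q := by
  have key : ∀ r ∈ R, ∀ a ∈ r, r = {b | Relation.ReflTransGen
      (fun x y => (∃ p ∈ P, x ∈ p ∧ y ∈ p) ∨ ∃ q ∈ Q, x ∈ q ∧ y ∈ q) a b} := by
    intro r hr a ha
    refine Set.Subset.antisymm (fun b hb => hconn r hr a ha b hb) fun b hb => ?_
    induction hb with
    | refl => exact ha
    | tail _ hstep ih =>
      obtain ⟨p, hp, hx, hy⟩ | ⟨q, hq, hx, hy⟩ := hstep
      · exact hP r hr p hp _ ih hx hy
      · exact hQ r hr q hq _ ih hx hy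
  ext r
  constructor
  · intro hr
    obtain ⟨a, ha⟩ := hne r hr
    exact ⟨a, hsub r hr ha, key r hr a ha⟩
  · rintro ⟨a, ha, rfl⟩
    obtain ⟨r, hr, har⟩ := hcov a ha
    rwa [← key r hr a har]

theorem mem_indSet_iff {G : Type} [Group G] {N : Subgroup G} {Z : Set (N → ℂ)} {χ : G → ℂ} :
    χ ∈ indSet N Z ↔ χ ∈ Irr G ∧ ∃ ψ ∈ Z, cInner N (resChar N χ) ψ ≠ 0 := by
  simp only [indSet, irrOverChar, Set.mem_iUnion, Set.mem_ofPred_eq, exists_prop]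
  tauto

section MClasses

variable {G : Type} [Group G] (N : Subgroup G) [N.Normal]

theorem mem_of_isConj {g h : G} (hg : g ∈ N) (hc : IsConj g h) : h ∈ N := by
  obtain ⟨c, rfl⟩ := isConj_iff.1 hc
  exact ‹N.Normal›.conj_mem g hg c

theorem notMem_of_isConj_mk {q : G ⧸ N} (hq : q ≠ 1) {g : G} (hc : IsConj q (g : G ⧸ N)) :
    g ∉ N := fun hg => by
  rw [(QuotientGroup.eq_one_iff g).2 hg, isConj_one_left] at hc
  exact hq hc

theorem cNormal_mClasses : CNormal (mClasses N) N := by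
  refine ⟨{C | ∃ g ∈ N, C = {h | IsConj g h}}, Set.subset_union_left, ?_⟩
  ext g
  constructor
  · exact fun hg => ⟨_, ⟨g, hg, rfl⟩, IsConj.refl g⟩
  · rintro ⟨_, ⟨x, hx, rfl⟩, hg⟩
    exact mem_of_isConj N hx hg

theorem exists_mem_mClasses_of_mk_eq {a b : G} (ha : a ∉ N) (hab : (a : G ⧸ N) = b) :
    ∃ C ∈ mClasses N, a ∈ C ∧ b ∈ C := by
  refine ⟨_, Or.inr ⟨a, fun h => ha ((QuotientGroup.eq_one_iff a).1 h), rfl⟩, IsConj.refl _, ?_⟩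
  change IsConj (a : G ⧸ N) (b : G ⧸ N)
  rw [hab]

theorem IsClassFun.res_mem_constFun_mClasses {θ : G → ℂ} (hθ : IsClassFun θ) :
    resChar N θ ∈ constFun (classesIn (mClasses N) N) := by
  rintro _ ⟨_, ⟨⟨g, -, rfl⟩ | ⟨q, hq, rfl⟩, -⟩, rfl⟩ a ha b hb
  · obtain ⟨c, hc⟩ := isConj_iff.1 ((IsConj.symm ha).trans hb)
    change θ a = θ b
    rw [← hc, hθ]
  · exact absurd a.2 (notMem_of_isConj_mk N hq ha)

theorem IrrOver.mem_constFun_mClasses [Finite G] {χ : G → ℂ} (hχ : χ ∈ IrrOver N) :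
    χ ∈ constFun (mClasses N) := by
  have hcl := Irr.isClassFun hχ.1
  rintro _ (⟨g, -, rfl⟩ | ⟨q, -, rfl⟩) a ha b hb
  · obtain ⟨c, rfl⟩ := isConj_iff.1 ((IsConj.symm ha).trans hb)
    rw [hcl]
  · obtain ⟨η, -, rfl⟩ := IrrOver.exists_inflate N hχ
    obtain ⟨c, hc⟩ := isConj_iff.1 ((IsConj.symm ha).trans hb)
    obtain ⟨c, rfl⟩ := QuotientGroup.mk_surjective c
    change η a = η b
    rw [← hc]
    exact (hcl a c).symm

end MClasses

section Join

variable {G : Type} [Group G] [Finite G] {𝒳 m𝒳 : Set (Set (G → ℂ))} {𝒦 : Set (Set G)}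
  {N : Subgroup G}

theorem cInner_ne_zero_iff_of_support {θ : G → ℂ} (hθ : IsClassFun (resChar N θ))
    (hsupp : ∀ g ∉ N, θ g = 0) (hθ0 : ∀ ψ ∈ Irr N, 0 ≤ cInner N (resChar N θ) ψ) {χ : G → ℂ}
    (hχ : χ ∈ Irr G) : cInner G θ χ ≠ 0 ↔
      ∃ ψ ∈ Irr N, cInner N (resChar N θ) ψ ≠ 0 ∧ cInner N (resChar N χ) ψ ≠ 0 := by
  rw [cInner_of_support N hsupp, mul_ne_zero_iff,
    and_iff_right (div_ne_zero (card_ne_zero_complex N) (card_ne_zero_complex G)),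
    cInner_ne_zero_iff_exists_common hθ hθ0 fun ψ hψ => Irr.cInner_res_nonneg N hχ hψ]

theorem cInner_zeroExtend_res_ne_zero_iff {X : Set (G → ℂ)} (hX : X ⊆ Irr G) {χ : G → ℂ}
    (hχ : χ ∈ Irr G) : cInner G (zeroExtend N (resChar N (sigmaChar X))) χ ≠ 0 ↔
      χ ∈ indSet N (constituentsOn N (sigmaChar X)) := by
  rw [cInner_ne_zero_iff_of_support (N := N) _ (fun g => zeroExtend_of_notMem N _) _ hχ,
    mem_indSet_iff, resChar_zeroExtend, and_iff_right hχ]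
  · exact exists_congr fun ψ => and_assoc.symm
  · rw [resChar_zeroExtend]
    exact (sigmaChar_isClassFun hX).res N
  · rw [resChar_zeroExtend]
    exact fun ψ hψ => cInner_res_sigmaChar_nonneg N hX hψ

theorem subset_indSet_constituentsOn {X : Set (G → ℂ)} (hX : X ⊆ Irr G) :
    X ⊆ indSet N (constituentsOn N (sigmaChar X)) := fun χ hχ => by
  obtain ⟨ψ, hψ, hne⟩ := Irr.exists_constituent N (hX hχ)
  exact mem_indSet_iff.2
    ⟨hX hχ, ψ, (mem_constituentsOn_sigmaChar N hX).2 ⟨hψ, χ, hχ, hne⟩, hne⟩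

variable [N.Normal]

theorem IsSCT.classes_join (h : IsSCT G 𝒳 𝒦) (hCN : CNormal 𝒦 N) :
    (fun K' => (Subtype.val '' K' : Set G)) '' classesIn 𝒦 N ∪
        ((fun L => ((QuotientGroup.mk : G → G ⧸ N) ⁻¹' L)) ''
          ((fun K => ((QuotientGroup.mk : G → G ⧸ N) '' K)) '' 𝒦) \ {(N : Set G)}) =
      PartJoin 𝒦 (mClasses N) := by
  have hval : ∀ K ⊆ (N : Set G), Subtype.val '' (Subtype.val ⁻¹' K : Set N) = K := fun K hK => by
    exact (Subtype.image_preimage_coe (N : Set G) K).trans (Set.inter_eq_right.2 hK)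
  have hpre : ∀ K ∈ 𝒦, K ⊆ N →
      (QuotientGroup.mk : G → G ⧸ N) ⁻¹' ((QuotientGroup.mk : G → G ⧸ N) '' K) = N := by
    intro K hK hKN
    obtain ⟨k, hk⟩ := h.2.1.nonempty hK
    have h1 : ∀ k ∈ K, (k : G ⧸ N) = 1 := fun k hk => (QuotientGroup.eq_one_iff k).2 (hKN hk)
    ext g
    rw [SetLike.mem_coe, ← QuotientGroup.eq_one_iff]
    constructor
    · rintro ⟨k', hk', hkg⟩
      rw [← hkg, h1 k' hk']
    · intro hg
      exact ⟨k, hk, (h1 k hk).trans hg.symm⟩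
  have hnot : ∀ K ∈ 𝒦,
      (QuotientGroup.mk : G → G ⧸ N) ⁻¹' ((QuotientGroup.mk : G → G ⧸ N) '' K) ≠ N →
      ∀ g : G, (g : G ⧸ N) ∈ (QuotientGroup.mk : G → G ⧸ N) '' K → g ∉ N := by
    rintro K hK hne g ⟨k, hk, hkg⟩ hg
    refine hne (hpre K hK (hCN.subset_of_mem h.2.1 hK hk ?_))
    rwa [← QuotientGroup.eq_one_iff, hkg, QuotientGroup.eq_one_iff]
  refine eq_partJoin ?_ ?_ ?_ ?_ ?_ ?_
  · rintro _ (⟨_, ⟨K, ⟨hK, hKN⟩, rfl⟩, rfl⟩ | ⟨⟨_, ⟨K, hK, rfl⟩, rfl⟩, hne⟩)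
    · simp only [hval K hKN]
      exact h.2.1.nonempty hK
    · obtain ⟨k, hk⟩ := h.2.1.nonempty hK
      exact ⟨k, k, hk, rfl⟩
  · intro r _ g _
    obtain ⟨K, hK, hg⟩ := h.2.1.exists_mem (Set.mem_univ g)
    exact ⟨K, hK, hg⟩
  · rintro g ⟨K, hK, hg⟩
    by_cases hgN : g ∈ N
    · have hKN := hCN.subset_of_mem h.2.1 hK hg hgN
      exact ⟨K, Or.inl ⟨_, ⟨K, ⟨hK, hKN⟩, rfl⟩, hval K hKN⟩, hg⟩
    · have hg' : g ∈ (QuotientGroup.mk : G → G ⧸ N) ⁻¹' ((QuotientGroup.mk : G → G ⧸ N) '' K) :=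
        ⟨g, hg, rfl⟩
      exact ⟨_, Or.inr ⟨⟨_, ⟨K, hK, rfl⟩, rfl⟩, fun hc => hgN ((Set.ext_iff.1 hc g).1 hg')⟩, hg'⟩
  · rintro _ (⟨_, ⟨K, ⟨hK, hKN⟩, rfl⟩, rfl⟩ | ⟨⟨_, ⟨K, hK, rfl⟩, rfl⟩, hne⟩) L hL x hx hxL
    · simp only [hval K hKN] at hx ⊢
      rw [h.2.1.eq_of_mem hK hL hx hxL]
    · exact Set.image_subset_iff.1 (h.image_mk_subset hCN hL hK ⟨x, hxL, rfl⟩ hx)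
  · rintro _ (⟨_, ⟨K, ⟨hK, hKN⟩, rfl⟩, rfl⟩ | ⟨⟨_, ⟨K, hK, rfl⟩, rfl⟩, hne⟩) _
      (⟨g, hg, rfl⟩ | ⟨q, hq, rfl⟩) x hx hxC y hyC
    · simp only [hval K hKN] at hx ⊢
      obtain ⟨c, rfl⟩ := isConj_iff.1 ((IsConj.symm hxC).trans hyC)
      exact h.conj_mem hK hx c
    · simp only [hval K hKN] at hx
      exact absurd (hKN hx) (notMem_of_isConj_mk N hq hxC)
    · exact absurd (mem_of_isConj N hg hxC) (hnot K hK hne x hx)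
    · obtain ⟨k, hk, hkx⟩ := hx
      obtain ⟨c, hc⟩ := isConj_iff.1 ((IsConj.symm hxC).trans hyC)
      obtain ⟨c, rfl⟩ := QuotientGroup.mk_surjective c
      refine ⟨c * k * c⁻¹, h.conj_mem hK hk c, ?_⟩
      rw [← hc, ← hkx]
      rfl
  · rintro _ (⟨_, ⟨K, ⟨hK, hKN⟩, rfl⟩, rfl⟩ | ⟨⟨_, ⟨K, hK, rfl⟩, rfl⟩, hne⟩) a ha b hb
    · simp only [hval K hKN] at ha hb
      exact .single (Or.inl ⟨K, hK, ha, hb⟩)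
    · have haN := hnot K hK hne a ha
      obtain ⟨k, hk, hka⟩ := ha
      obtain ⟨l, hl, hlb⟩ := hb
      have hlN := hnot K hK hne l ⟨l, hl, rfl⟩
      exact .head (Or.inr (exists_mem_mClasses_of_mk_eq N haN hka.symm))
        (.head (Or.inl ⟨K, hK, hk, hl⟩) (.single (Or.inr (exists_mem_mClasses_of_mk_eq N hlN hlb))))

theorem IsSCT.indSet_eq_IrrOver (h : IsSCT G 𝒳 𝒦) {X : Set (G → ℂ)} (hX : X ∈ 𝒳)
    (hXN : X ⊆ IrrOver N) : indSet N (constituentsOn N (sigmaChar X)) = IrrOver N := by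
  have hXi := h.1.2.1 X hX
  have h1 : constituentsOn N (sigmaChar X) = {1} := by
    ext ψ
    rw [mem_constituentsOn_sigmaChar N hXi, Set.mem_singleton_iff]
    constructor
    · rintro ⟨hψ, χ, hχ, hne⟩
      exact IrrOver.eq_one N (hXN hχ) hψ hne
    · rintro rfl
      obtain ⟨χ, hχ⟩ := h.1.nonempty hX
      exact ⟨one_mem_Irr N, χ, hχ, (mem_IrrOver_iff N (hXi hχ)).1 (hXN hχ)⟩
  ext χ
  rw [h1, mem_indSet_iff]
  simp only [Set.mem_singleton_iff, exists_eq_left]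
  exact ⟨fun hχ => (mem_IrrOver_iff N hχ.1).2 hχ.2, fun hχ => ⟨hχ.1, (mem_IrrOver_iff N hχ.1).1 hχ⟩⟩

theorem IsSCT.notMem_IrrOver_of_mem_indSet (h : IsSCT G 𝒳 𝒦) (hCN : CNormal 𝒦 N)
    {X : Set (G → ℂ)} (hX : X ∈ 𝒳)
    (hne : indSet N (constituentsOn N (sigmaChar X)) ≠ IrrOver N) {χ : G → ℂ}
    (hχ : χ ∈ indSet N (constituentsOn N (sigmaChar X))) : χ ∉ IrrOver N := fun hχN => by
  obtain ⟨hχi, ψ, hψ, hχψ⟩ := mem_indSet_iff.1 hχ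
  obtain ⟨hψi, χ₀, hχ₀, hχ₀ψ⟩ := (mem_constituentsOn_sigmaChar N (h.1.2.1 X hX)).1 hψ
  rw [IrrOver.eq_one N hχN hψi hχψ, ← mem_IrrOver_iff N (h.1.2.1 X hX hχ₀)] at hχ₀ψ
  exact hne (h.indSet_eq_IrrOver hX (h.subset_IrrOver hCN hX hχ₀ hχ₀ψ))

theorem IsSCT.sigmaChar_eq_zero_of_notMem (hm : IsSCT G m𝒳 (mClasses N)) {Y : Set (G → ℂ)}
    (hY : Y ∈ m𝒳) {χ : G → ℂ} (hχ : χ ∈ Y) (hχN : χ ∉ IrrOver N) {g : G} (hg : g ∉ N) :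
    sigmaChar Y g = 0 := by
  have hdisj : ∀ χ' ∈ Y, χ' ∉ IrrOver N := fun χ' hχ' hc =>
    hχN (hm.subset_IrrOver (cNormal_mClasses N) hY hχ' hc hχ)
  rw [← avg_eq_self N (θ := sigmaChar Y) (x := g), avg_sigmaChar_of_disjoint N (hm.1.2.1 Y hY) hdisj]
  · rfl
  · intro n
    obtain ⟨C, hC, hgC, hngC⟩ := exists_mem_mClasses_of_mk_eq N hg ((mk_eq_mk_iff N).2 ⟨n, rfl⟩)
    exact hm.2.2.2.2 Y hY C hC _ hngC _ hgC

theorem IsSCT.exists_common_part (hm : IsSCT G m𝒳 (mClasses N)) {χ χ' : G → ℂ} (hχ : χ ∈ Irr G)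
    (hχ' : χ' ∈ Irr G) (hχN : χ ∉ IrrOver N) {ψ : N → ℂ} (hψ : ψ ∈ Irr N)
    (hne : cInner N (resChar N χ) ψ ≠ 0) (hne' : cInner N (resChar N χ') ψ ≠ 0) :
    ∃ Y ∈ m𝒳, χ ∈ Y ∧ χ' ∈ Y := by
  obtain ⟨Y, hY, hχY⟩ := hm.1.exists_mem hχ
  have hYi := hm.1.2.1 Y hY
  have h1 := (cInner_ne_zero_iff_of_support ((sigmaChar_isClassFun hYi).res N)
    (fun g => hm.sigmaChar_eq_zero_of_notMem hY hχY hχN)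
    (fun φ hφ => cInner_res_sigmaChar_nonneg N hYi hφ) hχ').2
    ⟨ψ, hψ, ((mem_constituentsOn_sigmaChar N hYi).2 ⟨hψ, χ, hχY, hne⟩).2, hne'⟩
  rw [cInner_sigmaChar hYi hχ'] at h1
  exact ⟨Y, hY, hχY, by_contra fun hc => h1 (if_neg hc)⟩

theorem IsSCT.chars_join (h : IsSCT G 𝒳 𝒦) (hCN : CNormal 𝒦 N) (hm : IsSCT G m𝒳 (mClasses N)) :
    inflateSet N '' (deflate N '' {X ∈ 𝒳 | X ⊆ IrrOver N}) ∪
        ((fun X' => indSet N X') '' charsOn 𝒳 N \ {IrrOver N}) =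
      PartJoin 𝒳 m𝒳 := by
  refine eq_partJoin ?_ ?_ ?_ ?_ ?_ ?_
  · rintro _ (⟨_, ⟨X, ⟨hX, hXN⟩, rfl⟩, rfl⟩ | ⟨⟨_, ⟨X, hX, rfl⟩, rfl⟩, hne⟩)
    · rw [inflateSet_deflate N hXN]
      exact h.1.nonempty hX
    · exact (h.1.nonempty hX).mono (subset_indSet_constituentsOn (h.1.2.1 X hX))
  · rintro _ (⟨_, ⟨X, ⟨hX, hXN⟩, rfl⟩, rfl⟩ | ⟨⟨_, ⟨X, hX, rfl⟩, rfl⟩, hne⟩) χ hχ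
    · rw [inflateSet_deflate N hXN] at hχ
      exact ⟨X, hX, hχ⟩
    · obtain ⟨Y, hY, hχY⟩ := h.1.exists_mem (mem_indSet_iff.1 hχ).1
      exact ⟨Y, hY, hχY⟩
  · rintro χ ⟨X, hX, hχ⟩
    by_cases hχN : χ ∈ IrrOver N
    · have hXN := h.subset_IrrOver hCN hX hχ hχN
      exact ⟨X, Or.inl ⟨_, ⟨X, ⟨hX, hXN⟩, rfl⟩, inflateSet_deflate N hXN⟩, hχ⟩
    · have hχ' := subset_indSet_constituentsOn (N := N) (h.1.2.1 X hX) hχ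
      exact ⟨_, Or.inr ⟨⟨_, ⟨X, hX, rfl⟩, rfl⟩, fun hc => hχN (hc ▸ hχ')⟩, hχ'⟩
  · rintro _ (⟨_, ⟨X, ⟨hX, hXN⟩, rfl⟩, rfl⟩ | ⟨⟨_, ⟨X, hX, rfl⟩, rfl⟩, hne⟩) Y hY χ hχ hχY
    · rw [inflateSet_deflate N hXN] at hχ ⊢
      rw [h.1.eq_of_mem hX hY hχ hχY]
    · intro χ' hχ'
      refine (cInner_zeroExtend_res_ne_zero_iff (h.1.2.1 X hX) (h.1.2.1 Y hY hχ')).1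
        (h.cInner_ne_zero (zeroExtend_mem_constFun hCN h.2.1 (h.res_sigmaChar_mem hX)) hY hχY hχ' ?_)
      exact (cInner_zeroExtend_res_ne_zero_iff (h.1.2.1 X hX) (h.1.2.1 Y hY hχY)).2 hχ
  · rintro _ (⟨_, ⟨X, ⟨hX, hXN⟩, rfl⟩, rfl⟩ | ⟨⟨_, ⟨X, hX, rfl⟩, rfl⟩, hne⟩) Y hY χ hχ hχY χ' hχ'
    · rw [inflateSet_deflate N hXN] at hχ ⊢
      have h1 := hm.cInner_ne_zero (IrrOver.mem_constFun_mClasses N (hXN hχ)) hY hχY hχ'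
        (by rw [Irr.cInner_self (hXN hχ).1]; exact one_ne_zero)
      rw [Irr.cInner_eq (hXN hχ).1 (hm.1.2.1 Y hY hχ')] at h1
      exact (by_contra fun hc => h1 (if_neg hc) : χ = χ') ▸ hχ
    · have hXi := h.1.2.1 X hX
      refine (cInner_zeroExtend_res_ne_zero_iff hXi (hm.1.2.1 Y hY hχ')).1
        (hm.cInner_ne_zero (zeroExtend_mem_constFun (cNormal_mClasses N) hm.2.1
          ((sigmaChar_isClassFun hXi).res_mem_constFun_mClasses N)) hY hχY hχ' ?_)
      exact (cInner_zeroExtend_res_ne_zero_iff hXi (hm.1.2.1 Y hY hχY)).2 hχ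
  · rintro _ (⟨_, ⟨X, ⟨hX, hXN⟩, rfl⟩, rfl⟩ | ⟨⟨_, ⟨X, hX, rfl⟩, rfl⟩, hne⟩) χ hχ χ' hχ'
    · rw [inflateSet_deflate N hXN] at hχ hχ'
      exact .single (Or.inl ⟨X, hX, hχ, hχ'⟩)
    · have hXi := h.1.2.1 X hX
      have hχN := h.notMem_IrrOver_of_mem_indSet hCN hX hne hχ
      obtain ⟨hχi, ψ, hψ, hχψ⟩ := mem_indSet_iff.1 hχ
      obtain ⟨hψi, χ₁, hχ₁, hχ₁ψ⟩ := (mem_constituentsOn_sigmaChar N hXi).1 hψ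
      obtain ⟨hχi', ψ', hψ', hχψ'⟩ := mem_indSet_iff.1 hχ'
      obtain ⟨hψi', χ₂, hχ₂, hχ₂ψ⟩ := (mem_constituentsOn_sigmaChar N hXi).1 hψ'
      have hχ₂N := h.notMem_IrrOver_of_mem_indSet hCN hX hne (subset_indSet_constituentsOn hXi hχ₂)
      exact .head (Or.inr (hm.exists_common_part hχi (hXi hχ₁) hχN hψi hχψ hχ₁ψ))
        (.head (Or.inl ⟨X, hX, hχ₁, hχ₂⟩) (.single
          (Or.inr (hm.exists_common_part (hXi hχ₂) hχi' hχ₂N hψi' hχ₂ψ hχψ'))))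

end Join
end

/-- Proposition 6.4. If `N ⊴ G` is `𝒞`-normal, then
`𝒞_N = ({f(X) : X ∈ 𝒳}, {K ∈ 𝒦 : K ⊆ N})` is a `G`-invariant supercharacter theory
of `N`, `𝒞^{G/N} = ({X ∈ 𝒳 : X ⊆ Irr(G/N)}, {KN/N : K ∈ 𝒦})` is a supercharacter
theory of `G/N`, and `𝒞_N * 𝒞^{G/N} = 𝒞 ∨ m(N,G)`. -/
theorem stmt15 (G : Type) [Group G] [Finite G]
    (𝒳 : Set (Set (G → ℂ))) (𝒦 : Set (Set G)) (hSCT : IsSCT G 𝒳 𝒦)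
    (N : Subgroup G) [hN : N.Normal] (hCN : CNormal 𝒦 N) :
    -- 𝒞_N is a supercharacter theory of N ...
    IsSCT ↥N ((fun X => constituentsOn N (sigmaChar X)) '' 𝒳)
      ((fun K => (Subtype.val ⁻¹' K : Set ↥N)) '' {K ∈ 𝒦 | K ⊆ (N : Set G)}) ∧
    -- ... which is G-invariant,
    (∀ g : G, ∀ K' ∈ (fun K => (Subtype.val ⁻¹' K : Set ↥N)) '' {K ∈ 𝒦 | K ⊆ (N : Set G)},
      conjSub hN g '' K' = K') ∧
    -- 𝒞^{G/N} is a supercharacter theory of G/N,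
    IsSCT (G ⧸ N) (deflate N '' {X ∈ 𝒳 | X ⊆ IrrOver N})
      ((fun K => ((QuotientGroup.mk : G → G ⧸ N) '' K)) '' 𝒦) ∧
    -- and 𝒞_N * 𝒞^{G/N} = 𝒞 ∨ m(N,G):
    (∀ m𝒳 : Set (Set (G → ℂ)), IsSCT G m𝒳 (mClasses N) →
      (inflateSet N '' (deflate N '' {X ∈ 𝒳 | X ⊆ IrrOver N}) ∪
          ((fun X' => indSet N X') '' ((fun X => constituentsOn N (sigmaChar X)) '' 𝒳) \
            {IrrOver N})
        = PartJoin 𝒳 m𝒳) ∧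
      ((fun K' => (Subtype.val '' K' : Set G)) ''
            ((fun K => (Subtype.val ⁻¹' K : Set ↥N)) '' {K ∈ 𝒦 | K ⊆ (N : Set G)}) ∪
          ((fun L => ((QuotientGroup.mk : G → G ⧸ N) ⁻¹' L)) ''
              ((fun K => ((QuotientGroup.mk : G → G ⧸ N) '' K)) '' 𝒦) \
            {(N : Set G)})
        = PartJoin 𝒦 (mClasses N))) := by
  exact ⟨hSCT.restrict hCN, fun g _ hK' => hSCT.conjSub_image hN g hK', hSCT.quotient hCN,
    fun _ hm => ⟨hSCT.chars_join hCN hm, hSCT.classes_join hCN⟩⟩
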